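/- Let β⃗ be sub-critical and X ~ ERGM(β⃗) on 𝒢_n. For any fixed positive integer k and fixed a_1,…,a_k, b_1,…,b_k ∈ {0,1} there is a constant C > 0 such that for all sufficiently large n and any distinct edges j, i_1,…,i_k of K_n: (i) if j shares no vertex with any of i_1,…,i_k, then |ℙ(X_j = 1 | X_{i_1}=a_1,…,X_{i_k}=a_k) − ℙ(X_j = 1 | X_{i_1}=b_1,…,X_{i_k}=b_k)| ≤ C/n²; (ii) if j shares a vertex with some of i_1,…,i_k, then |ℙ(X_j = 1 | X_{i_1}=a_1,…,X_{i_k}=a_k) − ℙ(X_j = 1 | X_{i_1}=b_1,…,X_{i_k}=b_k)| ≤ C/n. -/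

import Mathlib

open Finset MeasureTheory Filter
open scoped ENNReal NNReal

namespace ERGM

/-- The set of edges of the complete graph on `Fin n`: non-diagonal unordered pairs. -/
abbrev EdgeSet (n : ℕ) : Type := {p : Sym2 (Fin n) // ¬ p.IsDiag}

/-- A configuration (graph on `n` vertices): an assignment of `true/false` to each edge. -/
abbrev Config (n : ℕ) : Type := EdgeSet n → Bool

/-- The value of the configuration `x` on the (unordered) pair `{i,j}`; `false` for `i = j`. -/
noncomputable def edgeVal {n : ℕ} (x : Config n) (i j : Fin n) : Bool :=
  if h : (s(i, j) : Sym2 (Fin n)).IsDiag then false else x ⟨s(i, j), h⟩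

/-- Real-valued indicator of presence of the edge `{i,j}` in `x`. -/
noncomputable def edgeInd {n : ℕ} (x : Config n) (i j : Fin n) : ℝ :=
  if edgeVal x i j = true then 1 else 0

open scoped Classical in
/-- Subgraph counting number `N_G(x)`: the number of copies of `G` in `x` (times the
number of automorphisms), i.e. the sum over injective `ψ` of the product of edge
indicators (each edge indicator is idempotent, so counting ordered adjacent pairs
yields the same value as counting edges). -/
noncomputable def NG {n m : ℕ} (G : SimpleGraph (Fin m)) (x : Config n) : ℝ :=
  ∑ ψ : Fin m ↪ Fin n, ∏ a : Fin m, ∏ b : Fin m,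
    if G.Adj a b then edgeInd x (ψ a) (ψ b) else 1

/-- The Hamiltonian `H(x) = Σ_i β_i N_{G_i}(x) / n^{|V_i|-2}`. -/
noncomputable def Hamiltonian {n s : ℕ} (V : Fin s → ℕ)
    (G : ∀ i, SimpleGraph (Fin (V i))) (β : Fin s → ℝ) (x : Config n) : ℝ :=
  ∑ i, β i * NG (G i) x / (n : ℝ) ^ (V i - 2)

/-- The ERGM probability mass function `π(x) ∝ exp(H(x))`. -/
noncomputable def ergmProb {n s : ℕ} (V : Fin s → ℕ)
    (G : ∀ i, SimpleGraph (Fin (V i))) (β : Fin s → ℝ) (x : Config n) : ℝ :=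
  Real.exp (Hamiltonian V G β x) / ∑ y : Config n, Real.exp (Hamiltonian V G β y)

/-- Expectation of `f` with respect to the mass function `w`. -/
noncomputable def expect {n : ℕ} (w : Config n → ℝ) (f : Config n → ℝ) : ℝ :=
  ∑ x : Config n, w x * f x

open scoped Classical in
/-- Probability of the event `A` with respect to the mass function `w`. -/
noncomputable def prob {n : ℕ} (w : Config n → ℝ) (A : Config n → Prop) : ℝ :=
  ∑ x : Config n, if A x then w x else 0

/-- The number of edges `|E(G)|` of a finite graph. -/
noncomputable def numEdges {m : ℕ} (G : SimpleGraph (Fin m)) : ℕ := G.edgeSet.ncard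

/-- `Ψ_β(p) = Σ_i 2 β_i |E_i| p^{|E_i|-1}`. -/
noncomputable def Psi {s : ℕ} (V : Fin s → ℕ) (G : ∀ i, SimpleGraph (Fin (V i)))
    (β : Fin s → ℝ) (p : ℝ) : ℝ :=
  ∑ i, 2 * β i * (numEdges (G i) : ℝ) * p ^ (numEdges (G i) - 1)

/-- `Φ(u) = e^u / (1 + e^u)`. -/
noncomputable def Phi (u : ℝ) : ℝ := Real.exp u / (1 + Real.exp u)

/-- `φ_β(p) = Φ(Ψ_β(p))`. -/
noncomputable def phiFn {s : ℕ} (V : Fin s → ℕ) (G : ∀ i, SimpleGraph (Fin (V i)))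
    (β : Fin s → ℝ) : ℝ → ℝ := fun p => Phi (Psi V G β p)

/-- `β` is sub-critical (high temperature) with fixed point `p`: `p` is the unique
solution of `φ_β(p) = p` and it satisfies `φ_β'(p) < 1`. -/
def Subcritical {s : ℕ} (V : Fin s → ℕ) (G : ∀ i, SimpleGraph (Fin (V i)))
    (β : Fin s → ℝ) (p : ℝ) : Prop :=
  phiFn V G β p = p ∧ (∀ q : ℝ, phiFn V G β q = q → q = p) ∧
    deriv (phiFn V G β) p < 1

/-- The discrete derivative `∂_e H(x) = H(x_{e+}) - H(x_{e-})`. -/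
noncomputable def dHam {n s : ℕ} (V : Fin s → ℕ) (G : ∀ i, SimpleGraph (Fin (V i)))
    (β : Fin s → ℝ) (e : EdgeSet n) (x : Config n) : ℝ :=
  Hamiltonian V G β (Function.update x e true) - Hamiltonian V G β (Function.update x e false)

/-- Real-valued indicator `X_e` of presence of edge `e`. -/
noncomputable def edgeX {n : ℕ} (e : EdgeSet n) (x : Config n) : ℝ := if x e = true then 1 else 0

/-- Two edges of `K_n` share a vertex. -/
def ShareVertex {n : ℕ} (e f : EdgeSet n) : Prop := ∃ v : Fin n, v ∈ e.1 ∧ v ∈ f.1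


/-- Conditional probability `ℙ(A | B)` under the mass function `w`. -/
noncomputable def condProb {n : ℕ} (w : Config n → ℝ) (A B : Config n → Prop) : ℝ :=
  prob w (fun x => A x ∧ B x) / prob w B

section ProductWeights

variable {E : Type*} [Fintype E] [DecidableEq E]

/-- The weight of a configuration under independent Bernoulli(`q`) coordinates. -/
noncomputable def bernWeight (q : ℝ) (x : E → Bool) : ℝ :=
  ∏ e, if x e = true then q else 1 - q

/-- The discrete derivative of `f` in the coordinate `e`. -/
def discDeriv (f : (E → Bool) → ℝ) (e : E) (x : E → Bool) : ℝ :=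
  f (Function.update x e true) - f (Function.update x e false)

omit [Fintype E] in
theorem discDeriv_update (f : (E → Bool) → ℝ) (e : E) (x : E → Bool) (b : Bool) :
    discDeriv f e (Function.update x e b) = discDeriv f e x := by
  simp [discDeriv]

omit [Fintype E] in
theorem discDeriv_comm (f : (E → Bool) → ℝ) (e e' : E) (x : E → Bool) :
    discDeriv (discDeriv f e) e' x = discDeriv (discDeriv f e') e x := by
  rcases eq_or_ne e e' with rfl | h
  · rfl
  · simp only [discDeriv, Function.update_comm h]
    ring

theorem sum_update_add (g : (E → Bool) → ℝ) (e : E) :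
    ∑ x, (g (Function.update x e true) + g (Function.update x e false)) = 2 * ∑ x, g x := by
  have hinv : Function.Involutive fun x : E → Bool => Function.update x e (!x e) := by
    intro x
    simp
  have h1 : ∀ x : E → Bool, g (Function.update x e true) + g (Function.update x e false)
      = g x + g (Function.update x e (!x e)) := by
    intro x
    cases hx : x e
    · rw [Bool.not_false, ← hx, Function.update_eq_self, add_comm]
    · rw [Bool.not_true, ← hx, Function.update_eq_self]
  have h2 : ∑ x, g (Function.update x e (!x e)) = ∑ x, g x := Equiv.sum_comp (hinv.toPerm _) g
  rw [Finset.sum_congr rfl fun x _ => h1 x, Finset.sum_add_distrib, h2]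
  ring

theorem sum_prod_apply (f : E → Bool → ℝ) :
    ∑ x : E → Bool, ∏ e, f e (x e) = ∏ e, (f e true + f e false) := by
  have := (Finset.prod_univ_sum (fun _ : E => (Finset.univ : Finset Bool)) f).symm
  rw [Fintype.piFinset_univ] at this
  simpa only [Fintype.sum_bool] using this

theorem bernWeight_sum (q : ℝ) : ∑ x : E → Bool, bernWeight q x = 1 := by
  have := sum_prod_apply (E := E) fun _ b => if b = true then q else 1 - q
  simpa [bernWeight] using this

omit [DecidableEq E] in
theorem bernWeight_pos {q : ℝ} (h0 : 0 < q) (h1 : q < 1) (x : E → Bool) :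
    0 < bernWeight q x := by
  refine Finset.prod_pos fun e _ => ?_
  split_ifs <;> linarith

theorem bernWeight_update (q : ℝ) (x : E → Bool) (e : E) (b : Bool) :
    bernWeight q (Function.update x e b) =
      (if b = true then q else 1 - q) *
        ∏ e' ∈ univ.erase e, if x e' = true then q else 1 - q := by
  rw [bernWeight, ← Finset.mul_prod_erase univ _ (mem_univ e), Function.update_self]
  congr 1
  refine Finset.prod_congr rfl fun e' he' => ?_
  rw [Function.update_of_ne (Finset.ne_of_mem_erase he')]

/-- Averaging a function over the coordinate `e` preserves its Bernoulli mean. -/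
theorem sum_bernWeight_average (q : ℝ) (f : (E → Bool) → ℝ) (e : E) :
    ∑ x, bernWeight q x * (q * f (Function.update x e true) +
      (1 - q) * f (Function.update x e false)) = ∑ x, bernWeight q x * f x := by
  have h1 := sum_update_add (fun x => bernWeight q x * (q * f (Function.update x e true) +
      (1 - q) * f (Function.update x e false))) e
  have h2 := sum_update_add (fun x => bernWeight q x * f x) e
  simp only [bernWeight_update, Function.update_idem, if_true, Bool.false_eq_true, if_false]
    at h1 h2
  have h3 : ∑ x : E → Bool, bernWeight q x * (q * f (Function.update x e true) +
      (1 - q) * f (Function.update x e false)) * 2 = ∑ x, bernWeight q x * f x * 2 := by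
    rw [← Finset.sum_mul, ← Finset.sum_mul, mul_comm, ← h1, mul_comm, ← h2]
    exact Finset.sum_congr rfl fun x _ => by ring
  rw [← Finset.sum_mul, ← Finset.sum_mul] at h3
  linarith

theorem sum_bernWeight_mul_prod_ind (q : ℝ) (S : Finset E) :
    ∑ x : E → Bool, bernWeight q x * ∏ e ∈ S, (if x e = true then (1 : ℝ) else 0)
      = q ^ S.card := by
  have h := sum_prod_apply (E := E) fun e b =>
    (if b = true then q else 1 - q) * (if e ∈ S then (if b = true then (1 : ℝ) else 0) else 1)
  have h2 : ∀ x : E → Bool,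
      bernWeight q x * ∏ e ∈ S, (if x e = true then (1 : ℝ) else 0) =
      ∏ e, (if x e = true then q else 1 - q) *
        (if e ∈ S then (if x e = true then (1 : ℝ) else 0) else 1) := by
    intro x
    rw [Finset.prod_mul_distrib, bernWeight, Finset.prod_ite_mem, Finset.univ_inter]
  rw [Finset.sum_congr rfl fun x _ => h2 x, h]
  have h3 : ∀ e : E, ((if true = true then q else 1 - q) *
        (if e ∈ S then (if true = true then (1 : ℝ) else 0) else 1) +
      (if false = true then q else 1 - q) *
        (if e ∈ S then (if false = true then (1 : ℝ) else 0) else 1)) =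
      if e ∈ S then q else 1 := by
    intro e
    by_cases he : e ∈ S <;> simp [he]
  rw [Finset.prod_congr rfl fun e _ => h3 e, Finset.prod_ite_mem, Finset.univ_inter,
    Finset.prod_const]

theorem sum_bernWeight_mul_prod_ind_false (q : ℝ) (S : Finset E) :
    ∑ x : E → Bool, bernWeight q x * ∏ e ∈ S, (if x e = true then (0 : ℝ) else 1)
      = (1 - q) ^ S.card := by
  have h := sum_prod_apply (E := E) fun e b =>
    (if b = true then q else 1 - q) * (if e ∈ S then (if b = true then (0 : ℝ) else 1) else 1)
  have h2 : ∀ x : E → Bool,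
      bernWeight q x * ∏ e ∈ S, (if x e = true then (0 : ℝ) else 1) =
      ∏ e, (if x e = true then q else 1 - q) *
        (if e ∈ S then (if x e = true then (0 : ℝ) else 1) else 1) := by
    intro x
    rw [Finset.prod_mul_distrib, bernWeight, Finset.prod_ite_mem, Finset.univ_inter]
  rw [Finset.sum_congr rfl fun x _ => h2 x, h]
  have h3 : ∀ e : E, ((if true = true then q else 1 - q) *
        (if e ∈ S then (if true = true then (0 : ℝ) else 1) else 1) +
      (if false = true then q else 1 - q) *
        (if e ∈ S then (if false = true then (0 : ℝ) else 1) else 1)) =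
      if e ∈ S then 1 - q else 1 := by
    intro e
    by_cases he : e ∈ S <;> simp [he]
  rw [Finset.prod_congr rfl fun e _ => h3 e, Finset.prod_ite_mem, Finset.univ_inter,
    Finset.prod_const]

theorem exp_le_add_exp_sq (t : ℝ) : Real.exp t ≤ t + Real.exp (t ^ 2) := by
  rcases le_or_gt |t| 1 with h | h
  · have h1 := (abs_le.mp (Real.abs_exp_sub_one_sub_id_le h)).2
    have h2 := Real.add_one_le_exp (t ^ 2)
    linarith
  · rcases le_or_gt 0 t with h0 | h0
    · rw [abs_of_nonneg h0] at h
      have : Real.exp t ≤ Real.exp (t ^ 2) := Real.exp_le_exp.mpr (by nlinarith)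
      linarith
    · rw [abs_of_neg h0] at h
      have h1 : Real.exp t ≤ 1 := Real.exp_le_one_iff.mpr h0.le
      have h2 := Real.add_one_le_exp (t ^ 2)
      nlinarith

theorem two_point_exp_le {q a b c : ℝ} (h0 : 0 ≤ q) (h1 : q ≤ 1) (h : |a - b| ≤ c) :
    q * Real.exp a + (1 - q) * Real.exp b
      ≤ Real.exp (c ^ 2) * Real.exp (q * a + (1 - q) * b) := by
  set m := q * a + (1 - q) * b with hm
  have hc : (a - b) ^ 2 ≤ c ^ 2 := sq_le_sq' (abs_le.mp h).1 (abs_le.mp h).2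
  have key : ∀ t : ℝ, t ^ 2 ≤ (a - b) ^ 2 → Real.exp t ≤ t + Real.exp (c ^ 2) := fun t ht =>
    (exp_le_add_exp_sq t).trans (by
      have := Real.exp_le_exp.mpr (ht.trans hc)
      linarith)
  have ha := key (a - m) (by
    have : a - m = (1 - q) * (a - b) := by rw [hm]; ring
    rw [this, mul_pow]
    exact mul_le_of_le_one_left (sq_nonneg _) (by nlinarith))
  have hb := key (b - m) (by
    have : b - m = -(q * (a - b)) := by rw [hm]; ring
    rw [this, neg_sq, mul_pow]
    exact mul_le_of_le_one_left (sq_nonneg _) (by nlinarith))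
  have hsum : q * Real.exp (a - m) + (1 - q) * Real.exp (b - m) ≤ Real.exp (c ^ 2) := by
    have := add_le_add (mul_le_mul_of_nonneg_left ha h0)
      (mul_le_mul_of_nonneg_left hb (sub_nonneg.mpr h1))
    refine this.trans (le_of_eq ?_)
    rw [hm]; ring
  calc q * Real.exp a + (1 - q) * Real.exp b
      = (q * Real.exp (a - m) + (1 - q) * Real.exp (b - m)) * Real.exp m := by
        rw [add_mul, mul_assoc, mul_assoc, ← Real.exp_add, ← Real.exp_add]
        simp
    _ ≤ _ := mul_le_mul_of_nonneg_right hsum (Real.exp_pos _).le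

/-- Exponential moment bound for functions with bounded differences. -/
theorem sum_bernWeight_exp_le {q : ℝ} (h0 : 0 < q) (h1 : q < 1) (S : Finset E) (c : E → ℝ)
    (f : (E → Bool) → ℝ) (hf : ∀ e x, |discDeriv f e x| ≤ if e ∈ S then c e else 0) :
    ∑ x, bernWeight q x * Real.exp (f x)
      ≤ Real.exp (∑ e ∈ S, c e ^ 2) * Real.exp (∑ x, bernWeight q x * f x) := by
  induction S using Finset.induction_on generalizing f with
  | empty =>
    have hup : ∀ (x : E → Bool) e b, f (Function.update x e b) = f x := by
      intro x e b
      have h2 : f (Function.update x e true) = f (Function.update x e false) := by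
        have := hf e x
        simp only [Finset.notMem_empty, if_false, abs_nonpos_iff, discDeriv] at this
        linarith
      have h3 : ∀ b', f (Function.update x e b') = f (Function.update x e true) := by
        intro b'; cases b'
        · exact h2.symm
        · rfl
      rw [h3 b, ← h3 (x e), Function.update_eq_self]
    have hconst : ∀ x, f x = f (fun _ => false) := by
      intro x
      have : ∀ T : Finset E, f (T.piecewise x fun _ => false) = f fun _ => false := by
        intro T
        induction T using Finset.induction_on with
        | empty => simp
        | insert e T he ih => rw [Finset.piecewise_insert, hup, ih]
      simpa using this univ
    have hf' : f = fun _ => f fun _ => false := funext hconst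
    rw [hf', ← Finset.sum_mul, ← Finset.sum_mul, bernWeight_sum]
    simp
  | insert e S he ih =>
    set g : (E → Bool) → ℝ := fun x => q * f (Function.update x e true) +
      (1 - q) * f (Function.update x e false) with hg
    have hgd : ∀ e' x, |discDeriv g e' x| ≤ if e' ∈ S then c e' else 0 := by
      intro e' x
      rcases eq_or_ne e' e with rfl | hne
      · simp [discDeriv, hg, he]
      · have e1 : discDeriv g e' x = q * discDeriv f e' (Function.update x e true) +
            (1 - q) * discDeriv f e' (Function.update x e false) := by
          simp only [discDeriv, hg, Function.update_comm hne]
          ring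
        have b1 := hf e' (Function.update x e true)
        have b2 := hf e' (Function.update x e false)
        simp only [Finset.mem_insert, hne, false_or] at b1 b2
        rw [e1]
        rw [abs_le] at b1 b2 ⊢
        constructor <;> nlinarith
    calc ∑ x, bernWeight q x * Real.exp (f x)
        = ∑ x, bernWeight q x * (q * Real.exp (f (Function.update x e true)) +
            (1 - q) * Real.exp (f (Function.update x e false))) :=
          (sum_bernWeight_average q (fun x => Real.exp (f x)) e).symm
      _ ≤ ∑ x, bernWeight q x * (Real.exp (c e ^ 2) * Real.exp (g x)) := by
          refine Finset.sum_le_sum fun x _ =>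
            mul_le_mul_of_nonneg_left ?_ (bernWeight_pos h0 h1 x).le
          refine two_point_exp_le h0.le h1.le ?_
          have := hf e x
          simpa [discDeriv] using this
      _ = Real.exp (c e ^ 2) * ∑ x, bernWeight q x * Real.exp (g x) := by
          rw [Finset.mul_sum]
          exact Finset.sum_congr rfl fun x _ => by ring
      _ ≤ Real.exp (c e ^ 2) * (Real.exp (∑ e ∈ S, c e ^ 2) *
            Real.exp (∑ x, bernWeight q x * g x)) :=
          mul_le_mul_of_nonneg_left (ih g hgd) (Real.exp_pos _).le
      _ = _ := by
          rw [Finset.sum_insert he, Real.exp_add, hg, sum_bernWeight_average]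
          ring

open scoped Classical in
/-- The total weight of the configurations satisfying `A`. -/
noncomputable def mass (w : (E → Bool) → ℝ) (A : (E → Bool) → Prop) : ℝ :=
  ∑ x, if A x then w x else 0

theorem mass_eq (w : (E → Bool) → ℝ) (A : (E → Bool) → Prop) [DecidablePred A] :
    mass w A = ∑ x, if A x then w x else 0 := by
  refine Finset.sum_congr rfl fun x _ => ?_
  congr

theorem mass_eq_sum_mul (w : (E → Bool) → ℝ) (A : (E → Bool) → Prop) [DecidablePred A] :
    mass w A = ∑ x, w x * if A x then 1 else 0 := by
  simp only [mass_eq, mul_boole]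

theorem mass_nonneg {w : (E → Bool) → ℝ} (hw : ∀ x, 0 ≤ w x) (A : (E → Bool) → Prop) :
    0 ≤ mass w A :=
  Finset.sum_nonneg fun x _ => by
    split_ifs
    · exact hw x
    · exact le_rfl

theorem mass_mono {w : (E → Bool) → ℝ} (hw : ∀ x, 0 ≤ w x) {A B : (E → Bool) → Prop}
    (h : ∀ x, A x → B x) : mass w A ≤ mass w B := by
  refine Finset.sum_le_sum fun x _ => ?_
  by_cases hA : A x
  · rw [if_pos hA, if_pos (h x hA)]
  · rw [if_neg hA]
    split_ifs
    · exact hw x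
    · exact le_rfl

theorem mass_or_le {w : (E → Bool) → ℝ} (hw : ∀ x, 0 ≤ w x) (A B : (E → Bool) → Prop) :
    mass w (fun x => A x ∨ B x) ≤ mass w A + mass w B := by
  rw [mass, mass, mass, ← Finset.sum_add_distrib]
  refine Finset.sum_le_sum fun x _ => ?_
  have := hw x
  by_cases hA : A x <;> by_cases hB : B x <;> simp [hA, hB, this]

theorem mass_exists_le {ι : Type*} [Fintype ι] {w : (E → Bool) → ℝ} (hw : ∀ x, 0 ≤ w x)
    (A : ι → (E → Bool) → Prop) :
    mass w (fun x => ∃ i, A i x) ≤ ∑ i, mass w (A i) := by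
  classical
  simp only [mass]
  rw [Finset.sum_comm]
  refine Finset.sum_le_sum fun x _ => ?_
  have hnn : ∀ i ∈ univ, 0 ≤ if A i x then w x else 0 := fun i _ => by
    split_ifs
    · exact hw x
    · exact le_rfl
  split_ifs with h
  · obtain ⟨i, hi⟩ := h
    have := Finset.single_le_sum hnn (mem_univ i)
    rwa [if_pos hi] at this
  · exact Finset.sum_nonneg hnn

/-- Bounded-differences tail inequality for Bernoulli product weights. -/
theorem bernWeight_tail {q : ℝ} (h0 : 0 < q) (h1 : q < 1) (c : E → ℝ) (f : (E → Bool) → ℝ)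
    (hf : ∀ e x, |discDeriv f e x| ≤ c e) {v η y : ℝ} (hv : 0 < v) (hη : 0 ≤ η)
    (hc : ∑ e, c e ^ 2 ≤ v) (hy : ∑ x, bernWeight q x * f x + η ≤ y) :
    mass (bernWeight q) (fun x => y ≤ f x) ≤ Real.exp (-(η ^ 2 / (4 * v))) := by
  classical
  set l := η / (2 * v) with hl
  have hl0 : 0 ≤ l := by positivity
  set m := ∑ x, bernWeight q x * f x with hm
  have hmgf := sum_bernWeight_exp_le h0 h1 univ (fun e => l * c e) (fun x => l * f x) (by
    intro e x
    have : discDeriv (fun x => l * f x) e x = l * discDeriv f e x := by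
      simp only [discDeriv]; ring
    rw [this, abs_mul, abs_of_nonneg hl0]
    simpa using mul_le_mul_of_nonneg_left (hf e x) hl0)
  have hmean : ∑ x, bernWeight q x * (l * f x) = l * m := by
    rw [hm, Finset.mul_sum]
    exact Finset.sum_congr rfl fun x _ => by ring
  have hsq : ∑ e, (l * c e) ^ 2 ≤ l ^ 2 * v := by
    simp only [mul_pow]
    rw [← Finset.mul_sum]
    exact mul_le_mul_of_nonneg_left hc (sq_nonneg l)
  rw [mass_eq_sum_mul]
  calc ∑ x, bernWeight q x * (if y ≤ f x then 1 else 0)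
      ≤ ∑ x, bernWeight q x * (Real.exp (l * f x) * Real.exp (-(l * y))) := by
        refine Finset.sum_le_sum fun x _ =>
          mul_le_mul_of_nonneg_left ?_ (bernWeight_pos h0 h1 x).le
        split_ifs with h
        · rw [← Real.exp_add]
          refine Real.one_le_exp ?_
          nlinarith
        · positivity
    _ = (∑ x, bernWeight q x * Real.exp (l * f x)) * Real.exp (-(l * y)) := by
        rw [Finset.sum_mul]
        exact Finset.sum_congr rfl fun x _ => by ring
    _ ≤ (Real.exp (∑ e, (l * c e) ^ 2) * Real.exp (∑ x, bernWeight q x * (l * f x))) *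
          Real.exp (-(l * y)) := mul_le_mul_of_nonneg_right hmgf (Real.exp_pos _).le
    _ = Real.exp (∑ e, (l * c e) ^ 2 + l * m - l * y) := by
        rw [hmean, ← Real.exp_add, ← Real.exp_add, sub_eq_add_neg]
    _ ≤ _ := by
        refine Real.exp_le_exp.mpr ?_
        have h3 : l * (m + η) ≤ l * y := mul_le_mul_of_nonneg_left hy hl0
        have h4 : l ^ 2 * v - l * η = -(η ^ 2 / (4 * v)) := by
          rw [hl]; field_simp; ring
        nlinarith

/-- Holley's inequality for two weights satisfying a one-coordinate comparison. -/
theorem sum_mul_le_of_update (μ ν : (E → Bool) → ℝ) (hμ : ∀ x, 0 ≤ μ x) (hν : ∀ x, 0 ≤ ν x)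
    (h : ∀ a b e, μ (Function.update a e true) * ν (Function.update b e false)
      ≤ μ (Function.update a e false) * ν (Function.update b e true))
    (f : (E → Bool) → ℝ) (hf : Monotone f) (hf0 : ∀ x, 0 ≤ f x) :
    (∑ x, f x * μ x) * ∑ x, ν x ≤ (∑ x, f x * ν x) * ∑ x, μ x := by
  have key : ∀ (S : Finset E) (a b : E → Bool), (∀ e, e ∉ S → a e ≤ b e) →
      μ a * ν b ≤ μ (a ⊓ b) * ν (a ⊔ b) := by
    intro S
    induction S using Finset.induction_on with
    | empty =>
      intro a b hab
      have hle : a ≤ b := fun e => hab e (Finset.notMem_empty e)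
      rw [inf_eq_left.mpr hle, sup_eq_right.mpr hle]
    | insert e S he ih =>
      intro a b hab
      by_cases hc : a e ≤ b e
      · refine ih a b fun e' he' => ?_
        rcases eq_or_ne e' e with rfl | hne
        · exact hc
        · exact hab e' (by simp [hne, he'])
      · have hae : a e = true := by
          cases h1 : a e
          · simp [h1] at hc
          · rfl
        have hbe : b e = false := by
          cases h1 : b e
          · rfl
          · simp [h1, Bool.le_true] at hc
        have h1 := h a b e
        have ea : Function.update a e true = a := by rw [← hae, Function.update_eq_self]
        have eb : Function.update b e false = b := by rw [← hbe, Function.update_eq_self]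
        rw [ea, eb] at h1
        refine h1.trans ((ih _ _ fun e' he' => ?_).trans (le_of_eq ?_))
        · rcases eq_or_ne e' e with rfl | hne
          · simp
          · simpa [hne] using hab e' (by simp [hne, he'])
        · congr 2 <;> funext e' <;> rcases eq_or_ne e' e with rfl | hne <;> simp [*]
  have := holley (α := E → Bool) (f := fun x => (∑ y, ν y) * μ x)
    (g := fun x => (∑ y, μ y) * ν x) (μ := f) (fun x => hf0 x)
    (fun x => mul_nonneg (Finset.sum_nonneg fun y _ => hν y) (hμ x))
    (fun x => mul_nonneg (Finset.sum_nonneg fun y _ => hμ y) (hν x)) hf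
    (by rw [← Finset.mul_sum, ← Finset.mul_sum, mul_comm])
    (fun a b => by
      have h2 := key univ a b (by simp)
      have h3 : 0 ≤ (∑ y, ν y) * ∑ y, μ y :=
        mul_nonneg (Finset.sum_nonneg fun y _ => hν y) (Finset.sum_nonneg fun y _ => hμ y)
      have := mul_le_mul_of_nonneg_left h2 h3
      linarith)
  calc _ = ∑ x, f x * ((∑ y, ν y) * μ x) := by
        rw [Finset.sum_mul]
        exact Finset.sum_congr rfl fun x _ => by ring
    _ ≤ _ := this
    _ = _ := by
        rw [Finset.sum_mul]
        exact Finset.sum_congr rfl fun x _ => by ring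

/-- Weights whose single-site odds are at most those of Bernoulli(`q`) are dominated by it. -/
theorem sum_mul_le_bernWeight {q : ℝ} (h0 : 0 < q) (h1 : q < 1) (ν : (E → Bool) → ℝ)
    (hν : ∀ x, 0 ≤ ν x)
    (h : ∀ a e, (1 - q) * ν (Function.update a e true) ≤ q * ν (Function.update a e false))
    (f : (E → Bool) → ℝ) (hf : Monotone f) (hf0 : ∀ x, 0 ≤ f x) :
    ∑ x, f x * ν x ≤ (∑ x, bernWeight q x * f x) * ∑ x, ν x := by
  have := sum_mul_le_of_update ν (bernWeight q) hν (fun x => (bernWeight_pos h0 h1 x).le)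
    (fun a b e => by
      rw [bernWeight_update, bernWeight_update]
      simp only [Bool.false_eq_true, if_false, if_true]
      have hp : 0 ≤ ∏ e' ∈ univ.erase e, if b e' = true then q else 1 - q :=
        Finset.prod_nonneg fun e' _ => by split_ifs <;> linarith
      have := mul_le_mul_of_nonneg_right (h a e) hp
      linarith) f hf hf0
  rw [bernWeight_sum, mul_one] at this
  simpa only [mul_comm (f _) (bernWeight _ _)] using this

/-- Weights whose single-site odds are at least those of Bernoulli(`q`) dominate it. -/
theorem bernWeight_mul_le_sum {q : ℝ} (h0 : 0 < q) (h1 : q < 1) (ν : (E → Bool) → ℝ)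
    (hν : ∀ x, 0 ≤ ν x)
    (h : ∀ a e, q * ν (Function.update a e false) ≤ (1 - q) * ν (Function.update a e true))
    (f : (E → Bool) → ℝ) (hf : Monotone f) (hf0 : ∀ x, 0 ≤ f x) :
    (∑ x, bernWeight q x * f x) * ∑ x, ν x ≤ ∑ x, f x * ν x := by
  have := sum_mul_le_of_update (bernWeight q) ν (fun x => (bernWeight_pos h0 h1 x).le) hν
    (fun a b e => by
      rw [bernWeight_update, bernWeight_update]
      simp only [Bool.false_eq_true, if_false, if_true]
      have hp : 0 ≤ ∏ e' ∈ univ.erase e, if a e' = true then q else 1 - q :=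
        Finset.prod_nonneg fun e' _ => by split_ifs <;> linarith
      have := mul_le_mul_of_nonneg_right (h b e) hp
      linarith) f hf hf0
  rw [bernWeight_sum, mul_one] at this
  simpa only [mul_comm (f _) (bernWeight _ _)] using this

end ProductWeights

section Gibbs

theorem Phi_pos (t : ℝ) : 0 < Phi t := by
  unfold Phi; positivity

theorem Phi_lt_one (t : ℝ) : Phi t < 1 := by
  unfold Phi
  rw [div_lt_one (by positivity)]
  linarith

theorem one_sub_Phi_mul_exp (t : ℝ) : (1 - Phi t) * Real.exp t = Phi t := by
  unfold Phi
  have : (1 + Real.exp t) ≠ 0 := by positivity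
  field_simp
  ring

theorem hasDerivAt_Phi (t : ℝ) : HasDerivAt Phi (Phi t * (1 - Phi t)) t := by
  have h : (1 + Real.exp t) ≠ 0 := by positivity
  have := (Real.hasDerivAt_exp t).div ((Real.hasDerivAt_exp t).const_add 1) h
  refine this.congr_deriv ?_
  unfold Phi
  field_simp

theorem continuous_Phi : Continuous Phi :=
  continuous_iff_continuousAt.mpr fun t => (hasDerivAt_Phi t).continuousAt

theorem Phi_monotone : Monotone Phi := by
  refine monotone_of_deriv_nonneg (fun t => (hasDerivAt_Phi t).differentiableAt) fun t => ?_
  rw [(hasDerivAt_Phi t).deriv]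
  exact mul_nonneg (Phi_pos t).le (sub_nonneg.mpr (Phi_lt_one t).le)

theorem Phi_sub_le {a l u s t : ℝ} (ha : ∀ r ∈ Set.Icc l u, Phi r * (1 - Phi r) ≤ a)
    (hl : l ≤ s) (hst : s ≤ t) (hu : t ≤ u) : Phi t - Phi s ≤ a * (t - s) := by
  refine (convex_Icc l u).image_sub_le_mul_sub_of_deriv_le continuous_Phi.continuousOn
    (fun r _ => (hasDerivAt_Phi r).differentiableAt.differentiableWithinAt)
    (fun r hr => ?_) s ⟨hl, hst.trans hu⟩ t ⟨hl.trans hst, hu⟩ hst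
  rw [(hasDerivAt_Phi r).deriv]
  exact ha r (interior_subset hr)

variable {E : Type*} [Fintype E] [DecidableEq E]

/-- The Gibbs weight of the Hamiltonian `H`. -/
noncomputable def gibbs (H : (E → Bool) → ℝ) (x : E → Bool) : ℝ :=
  Real.exp (H x) / ∑ y, Real.exp (H y)

theorem gibbs_pos (H : (E → Bool) → ℝ) (x : E → Bool) : 0 < gibbs H x :=
  div_pos (Real.exp_pos _) (Finset.sum_pos (fun _ _ => Real.exp_pos _) Finset.univ_nonempty)

theorem gibbs_sum (H : (E → Bool) → ℝ) : ∑ x, gibbs H x = 1 := by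
  simp only [gibbs]
  rw [← Finset.sum_div]
  exact div_self (Finset.sum_pos (fun _ _ => Real.exp_pos _) Finset.univ_nonempty).ne'

theorem gibbs_update_true (H : (E → Bool) → ℝ) (e : E) (x : E → Bool) :
    gibbs H (Function.update x e true) =
      gibbs H (Function.update x e false) * Real.exp (discDeriv H e x) := by
  rw [gibbs, gibbs, discDeriv, div_mul_eq_mul_div, ← Real.exp_add]
  ring_nf

/-- `H` is supermodular on the Boolean lattice. -/
def Supermodular (H : (E → Bool) → ℝ) : Prop :=
  ∀ a b, H a + H b ≤ H (a ⊓ b) + H (a ⊔ b)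

omit [Fintype E] in
theorem Supermodular.monotone_discDeriv {H : (E → Bool) → ℝ} (hH : Supermodular H) (e : E) :
    Monotone (discDeriv H e) := by
  intro a b hab
  have h := hH (Function.update a e true) (Function.update b e false)
  have h1 : Function.update a e true ⊓ Function.update b e false = Function.update a e false := by
    funext e'
    rcases eq_or_ne e' e with rfl | hne
    · simp
    · simp only [Pi.inf_apply, Function.update_of_ne hne]
      exact inf_eq_left.mpr (hab e')
  have h2 : Function.update a e true ⊔ Function.update b e false = Function.update b e true := by
    funext e'
    rcases eq_or_ne e' e with rfl | hne
    · simp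
    · simp only [Pi.sup_apply, Function.update_of_ne hne]
      exact sup_eq_right.mpr (hab e')
  rw [h1, h2] at h
  simp only [discDeriv]
  linarith

/-- If all local fields lie below `t`, the Gibbs weight is dominated by Bernoulli(`Phi t`). -/
theorem gibbs_mass_exists_le {ι : Type*} [Fintype ι] {H : (E → Bool) → ℝ}
    (hH : Supermodular H) (t y : ℝ) (Y : ι → (E → Bool) → ℝ) (hY : ∀ i, Monotone (Y i)) :
    mass (gibbs H) (fun x => ∃ i, y ≤ Y i x) ≤
      mass (gibbs H) (fun x => ∃ e, t ≤ discDeriv H e x) +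
        ∑ i, mass (bernWeight (Phi t)) (fun x => y ≤ Y i x) := by
  classical
  set D : (E → Bool) → Prop := fun x => ∀ e, discDeriv H e x < t with hD
  set ν : (E → Bool) → ℝ := fun x => if D x then gibbs H x else 0 with hνdef
  have hν : ∀ x, 0 ≤ ν x := fun x => by
    simp only [hνdef]
    split_ifs
    · exact (gibbs_pos H x).le
    · exact le_rfl
  have hdom := sum_mul_le_bernWeight (Phi_pos t) (Phi_lt_one t) ν hν (fun a e => by
      simp only [hνdef]
      by_cases h1 : D (Function.update a e true)
      · have h2 : D (Function.update a e false) := fun e' =>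
          (hH.monotone_discDeriv e' (update_le_update_iff.mpr
            ⟨Bool.false_le _, fun _ _ => le_rfl⟩)).trans_lt (h1 e')
        rw [if_pos h1, if_pos h2, gibbs_update_true]
        have h3 := h1 e
        rw [discDeriv_update] at h3
        have h4 : (1 - Phi t) * Real.exp (discDeriv H e a) ≤ Phi t := by
          conv_rhs => rw [← one_sub_Phi_mul_exp t]
          exact mul_le_mul_of_nonneg_left (Real.exp_le_exp.mpr h3.le)
            (sub_nonneg.mpr (Phi_lt_one t).le)
        have := mul_le_mul_of_nonneg_right h4 (gibbs_pos H (Function.update a e false)).le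
        linarith
      · rw [if_neg h1, mul_zero]
        exact mul_nonneg (Phi_pos t).le (hν _))
    (fun x => if ∃ i, y ≤ Y i x then 1 else 0)
    (fun x z hxz => by
      by_cases h1 : ∃ i, y ≤ Y i x
      · obtain ⟨i, hi⟩ := h1
        have h2 : ∃ i, y ≤ Y i z := ⟨i, hi.trans (hY i hxz)⟩
        simp only [if_pos h2]
        split_ifs <;> norm_num
      · simp only [if_neg h1]
        split_ifs <;> norm_num)
    (fun x => by split_ifs <;> norm_num)
  have hνle : ∑ x, ν x ≤ 1 := by
    rw [← gibbs_sum H]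
    refine Finset.sum_le_sum fun x _ => ?_
    simp only [hνdef]
    split_ifs
    · exact le_rfl
    · exact (gibbs_pos H x).le
  have hb0 : ∀ x : E → Bool, 0 ≤ bernWeight (Phi t) x := fun x =>
    (bernWeight_pos (Phi_pos t) (Phi_lt_one t) x).le
  calc mass (gibbs H) (fun x => ∃ i, y ≤ Y i x)
      ≤ mass (gibbs H) (fun x => ∃ e, t ≤ discDeriv H e x) +
        ∑ x, (if ∃ i, y ≤ Y i x then 1 else 0) * ν x := by
        rw [mass_eq, mass_eq, ← Finset.sum_add_distrib]
        refine Finset.sum_le_sum fun x _ => ?_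
        have hg := (gibbs_pos H x).le
        by_cases h1 : ∃ e, t ≤ discDeriv H e x
        · rw [if_pos h1]
          have : 0 ≤ (if ∃ i, y ≤ Y i x then (1 : ℝ) else 0) * ν x :=
            mul_nonneg (by split_ifs <;> norm_num) (hν x)
          split_ifs at this ⊢ <;> linarith
        · have hDx : D x := by simpa [hD] using h1
          rw [if_neg h1]
          simp only [hνdef, if_pos hDx, zero_add, boole_mul]
          exact le_rfl
    _ ≤ mass (gibbs H) (fun x => ∃ e, t ≤ discDeriv H e x) +
        mass (bernWeight (Phi t)) (fun x => ∃ i, y ≤ Y i x) := by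
        have h2 : 0 ≤ mass (bernWeight (Phi t)) (fun x => ∃ i, y ≤ Y i x) := mass_nonneg hb0 _
        have h3 := mass_eq_sum_mul (bernWeight (Phi t)) (fun x => ∃ i, y ≤ Y i x)
        rw [← h3] at hdom
        have := mul_le_mul_of_nonneg_left hνle h2
        linarith
    _ ≤ _ := by
        have := mass_exists_le hb0 (fun i x => y ≤ Y i x)
        linarith

/-- If all local fields lie above `t`, the Gibbs weight dominates Bernoulli(`Phi t`). -/
theorem gibbs_mass_exists_ge {ι : Type*} [Fintype ι] {H : (E → Bool) → ℝ}
    (hH : Supermodular H) (t y : ℝ) (Y : ι → (E → Bool) → ℝ) (hY : ∀ i, Monotone (Y i)) :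
    mass (gibbs H) (fun x => ∃ i, Y i x ≤ y) ≤
      mass (gibbs H) (fun x => ∃ e, discDeriv H e x ≤ t) +
        ∑ i, mass (bernWeight (Phi t)) (fun x => Y i x ≤ y) := by
  classical
  set D : (E → Bool) → Prop := fun x => ∀ e, t < discDeriv H e x with hD
  set ν : (E → Bool) → ℝ := fun x => if D x then gibbs H x else 0 with hνdef
  have hν : ∀ x, 0 ≤ ν x := fun x => by
    simp only [hνdef]
    split_ifs
    · exact (gibbs_pos H x).le
    · exact le_rfl
  have hdom := bernWeight_mul_le_sum (Phi_pos t) (Phi_lt_one t) ν hν (fun a e => by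
      simp only [hνdef]
      by_cases h1 : D (Function.update a e false)
      · have h2 : D (Function.update a e true) := fun e' =>
          (h1 e').trans_le (hH.monotone_discDeriv e' (update_le_update_iff.mpr
            ⟨Bool.false_le _, fun _ _ => le_rfl⟩))
        rw [if_pos h1, if_pos h2, gibbs_update_true]
        have h3 := h1 e
        rw [discDeriv_update] at h3
        have h4 : Phi t ≤ (1 - Phi t) * Real.exp (discDeriv H e a) := by
          conv_lhs => rw [← one_sub_Phi_mul_exp t]
          exact mul_le_mul_of_nonneg_left (Real.exp_le_exp.mpr h3.le)
            (sub_nonneg.mpr (Phi_lt_one t).le)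
        have := mul_le_mul_of_nonneg_right h4 (gibbs_pos H (Function.update a e false)).le
        linarith
      · rw [if_neg h1, mul_zero]
        exact mul_nonneg (sub_nonneg.mpr (Phi_lt_one t).le) (hν _))
    (fun x => 1 - if ∃ i, Y i x ≤ y then 1 else 0)
    (fun x z hxz => by
      by_cases h1 : ∃ i, Y i z ≤ y
      · obtain ⟨i, hi⟩ := h1
        have h2 : ∃ i, Y i x ≤ y := ⟨i, (hY i hxz).trans hi⟩
        simp only [if_pos h2]
        split_ifs <;> norm_num
      · simp only [if_neg h1]
        split_ifs <;> norm_num)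
    (fun x => by split_ifs <;> norm_num)
  have hνle : ∑ x, ν x ≤ 1 := by
    rw [← gibbs_sum H]
    refine Finset.sum_le_sum fun x _ => ?_
    simp only [hνdef]
    split_ifs
    · exact le_rfl
    · exact (gibbs_pos H x).le
  have hb0 : ∀ x : E → Bool, 0 ≤ bernWeight (Phi t) x := fun x =>
    (bernWeight_pos (Phi_pos t) (Phi_lt_one t) x).le
  calc mass (gibbs H) (fun x => ∃ i, Y i x ≤ y)
      ≤ mass (gibbs H) (fun x => ∃ e, discDeriv H e x ≤ t) +
        ∑ x, (if ∃ i, Y i x ≤ y then 1 else 0) * ν x := by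
        rw [mass_eq, mass_eq, ← Finset.sum_add_distrib]
        refine Finset.sum_le_sum fun x _ => ?_
        have hg := (gibbs_pos H x).le
        by_cases h1 : ∃ e, discDeriv H e x ≤ t
        · rw [if_pos h1]
          have : 0 ≤ (if ∃ i, Y i x ≤ y then (1 : ℝ) else 0) * ν x :=
            mul_nonneg (by split_ifs <;> norm_num) (hν x)
          split_ifs at this ⊢ <;> linarith
        · have hDx : D x := by simpa [hD] using h1
          rw [if_neg h1]
          simp only [hνdef, if_pos hDx, zero_add, boole_mul]
          exact le_rfl
    _ ≤ mass (gibbs H) (fun x => ∃ e, discDeriv H e x ≤ t) +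
        mass (bernWeight (Phi t)) (fun x => ∃ i, Y i x ≤ y) := by
        have h2 : 0 ≤ mass (bernWeight (Phi t)) (fun x => ∃ i, Y i x ≤ y) := mass_nonneg hb0 _
        have h3 := mass_eq_sum_mul (bernWeight (Phi t)) (fun x => ∃ i, Y i x ≤ y)
        simp only [mul_sub, sub_mul, Finset.sum_sub_distrib, mul_one, one_mul] at hdom
        rw [← h3, bernWeight_sum] at hdom
        have := mul_le_mul_of_nonneg_left hνle h2
        linarith
    _ ≤ _ := by
        have := mass_exists_le hb0 (fun i x => Y i x ≤ y)
        linarith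

/-- Conditional Gibbs means of increasing functions increase with the boundary condition. -/
theorem gibbs_sum_pinned_le {κ : Type*} {H : (E → Bool) → ℝ} (hH : Supermodular H)
    (i : κ → E) {a b : κ → Bool} (hab : a ≤ b) {g : (E → Bool) → ℝ} (hg : Monotone g) :
    (∑ x, gibbs H x * g x * (open scoped Classical in if ∀ t, x (i t) = a t then 1 else 0)) *
        mass (gibbs H) (fun x => ∀ t, x (i t) = b t) ≤
      (∑ x, gibbs H x * g x * (open scoped Classical in if ∀ t, x (i t) = b t then 1 else 0)) *
        mass (gibbs H) (fun x => ∀ t, x (i t) = a t) := by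
  classical
  set fa : (E → Bool) → ℝ := fun x => gibbs H x * if ∀ t, x (i t) = a t then 1 else 0 with hfa
  set fb : (E → Bool) → ℝ := fun x => gibbs H x * if ∀ t, x (i t) = b t then 1 else 0 with hfb
  have ha0 : ∀ x, 0 ≤ fa x := fun x =>
    mul_nonneg (gibbs_pos H x).le (by split_ifs <;> norm_num)
  have hb0 : ∀ x, 0 ≤ fb x := fun x =>
    mul_nonneg (gibbs_pos H x).le (by split_ifs <;> norm_num)
  have hA : mass (gibbs H) (fun x => ∀ t, x (i t) = a t) = ∑ x, fa x := mass_eq_sum_mul _ _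
  have hB : mass (gibbs H) (fun x => ∀ t, x (i t) = b t) = ∑ x, fb x := mass_eq_sum_mul _ _
  have hlat : ∀ x y, fa x * fb y ≤ fa (x ⊓ y) * fb (x ⊔ y) := by
    intro x y
    by_cases hx : ∀ t, x (i t) = a t
    · by_cases hy : ∀ t, y (i t) = b t
      · have h1 : ∀ t, (x ⊓ y) (i t) = a t := fun t => by
          rw [Pi.inf_apply, hx t, hy t]; exact inf_eq_left.mpr (hab t)
        have h2 : ∀ t, (x ⊔ y) (i t) = b t := fun t => by
          rw [Pi.sup_apply, hx t, hy t]; exact sup_eq_right.mpr (hab t)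
        simp only [hfa, hfb, if_pos hx, if_pos hy, if_pos h1, if_pos h2, mul_one, gibbs]
        rw [div_mul_div_comm, div_mul_div_comm, ← Real.exp_add, ← Real.exp_add]
        exact div_le_div_of_nonneg_right (Real.exp_le_exp.mpr (hH x y))
          (mul_nonneg (Finset.sum_nonneg fun _ _ => (Real.exp_pos _).le)
            (Finset.sum_nonneg fun _ _ => (Real.exp_pos _).le))
      · have : fb y = 0 := by simp only [hfb, if_neg hy, mul_zero]
        rw [this, mul_zero]
        exact mul_nonneg (ha0 _) (hb0 _)
    · have : fa x = 0 := by simp only [hfa, if_neg hx, mul_zero]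
      rw [this, zero_mul]
      exact mul_nonneg (ha0 _) (hb0 _)
  set c : ℝ := g ⊥ with hc
  have hsA : 0 ≤ ∑ y, fa y := Finset.sum_nonneg fun y _ => ha0 y
  have hsB : 0 ≤ ∑ y, fb y := Finset.sum_nonneg fun y _ => hb0 y
  have hol := holley (α := E → Bool) (f := fun x => (∑ y, fb y) * fa x)
    (g := fun x => (∑ y, fa y) * fb x) (μ := fun x => g x - c)
    (fun x => sub_nonneg.mpr (hg bot_le))
    (fun x => mul_nonneg hsB (ha0 x)) (fun x => mul_nonneg hsA (hb0 x))
    (fun x y hxy => sub_le_sub_right (hg hxy) c)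
    (by rw [← Finset.mul_sum, ← Finset.mul_sum, mul_comm])
    (fun x y => by
      have := mul_le_mul_of_nonneg_left (hlat x y) (mul_nonneg hsA hsB)
      linarith)
  have e1 : ∑ x, (g x - c) * ((∑ y, fb y) * fa x) =
      (∑ x, gibbs H x * g x * if ∀ t, x (i t) = a t then 1 else 0) * (∑ y, fb y) -
        c * (∑ y, fa y) * (∑ y, fb y) := by
    rw [Finset.mul_sum (a := c), Finset.sum_mul, Finset.sum_mul, ← Finset.sum_sub_distrib]
    exact Finset.sum_congr rfl fun x _ => by simp only [hfa]; ring
  have e2 : ∑ x, (g x - c) * ((∑ y, fa y) * fb x) =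
      (∑ x, gibbs H x * g x * if ∀ t, x (i t) = b t then 1 else 0) * (∑ y, fa y) -
        c * (∑ y, fb y) * (∑ y, fa y) := by
    rw [Finset.mul_sum (a := c), Finset.sum_mul, Finset.sum_mul, ← Finset.sum_sub_distrib]
    exact Finset.sum_congr rfl fun x _ => by simp only [hfb]; ring
  have hol' : ∑ x, (g x - c) * ((∑ y, fb y) * fa x) ≤
      ∑ x, (g x - c) * ((∑ y, fa y) * fb x) := hol
  rw [e1, e2] at hol'
  rw [hA, hB]
  linarith

/-- The single-site conditional distribution identity under pinning of other coordinates. -/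
theorem gibbs_sum_pinned_apply {κ : Type*} (H : (E → Bool) → ℝ) (i : κ → E) (a : κ → Bool)
    (e : E) (he : ∀ t, i t ≠ e) :
    (∑ x, gibbs H x * (if x e = true then 1 else 0) *
        (open scoped Classical in if ∀ t, x (i t) = a t then 1 else 0)) =
      ∑ x, gibbs H x * Phi (discDeriv H e x) *
        (open scoped Classical in if ∀ t, x (i t) = a t then 1 else 0) := by
  classical
  rw [← sub_eq_zero, ← Finset.sum_sub_distrib]
  have h := sum_update_add (fun x => gibbs H x * (if x e = true then 1 else 0) *
        (if ∀ t, x (i t) = a t then 1 else 0) - gibbs H x * Phi (discDeriv H e x) *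
        (if ∀ t, x (i t) = a t then 1 else 0)) e
  have h0 : ∀ x : E → Bool, ∀ b, (∀ t, Function.update x e b (i t) = a t) ↔
      ∀ t, x (i t) = a t := fun x b =>
    forall_congr' fun t => by rw [Function.update_of_ne (he t)]
  simp only [h0, discDeriv_update, Function.update_self, if_true, Bool.false_eq_true, if_false,
    gibbs_update_true] at h
  have h1 : ∀ x : E → Bool, (1 - Phi (discDeriv H e x)) * Real.exp (discDeriv H e x) =
    Phi (discDeriv H e x) := fun x => one_sub_Phi_mul_exp _
  rw [Finset.sum_eq_zero] at h
  · linarith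
  · intro x _
    linear_combination (gibbs H (Function.update x e false) *
      if ∀ t, x (i t) = a t then 1 else 0) * h1 x

theorem gibbs_mass_forall_true_ge {H : (E → Bool) → ℝ} {B : ℝ}
    (hB : ∀ e x, -B ≤ discDeriv H e x) (S : Finset E) :
    Phi (-B) ^ S.card ≤ mass (gibbs H) (fun x => ∀ e ∈ S, x e = true) := by
  classical
  have hdom := bernWeight_mul_le_sum (Phi_pos (-B)) (Phi_lt_one (-B)) (gibbs H)
    (fun x => (gibbs_pos H x).le) (fun a e => by
      rw [gibbs_update_true]
      have h4 : Phi (-B) ≤ (1 - Phi (-B)) * Real.exp (discDeriv H e a) := by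
        conv_lhs => rw [← one_sub_Phi_mul_exp (-B)]
        exact mul_le_mul_of_nonneg_left (Real.exp_le_exp.mpr (hB e a))
          (sub_nonneg.mpr (Phi_lt_one _).le)
      have := mul_le_mul_of_nonneg_right h4 (gibbs_pos H (Function.update a e false)).le
      linarith)
    (fun x => ∏ e ∈ S, if x e = true then (1 : ℝ) else 0)
    (fun x y hxy => Finset.prod_le_prod (fun e _ => by split_ifs <;> norm_num) fun e _ => by
      have := hxy e
      by_cases h : x e = true
      · have hy : y e = true := by rw [h] at this; exact top_le_iff.mp this
        simp [h, hy]
      · rw [if_neg h]; split_ifs <;> norm_num)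
    (fun x => Finset.prod_nonneg fun e _ => by split_ifs <;> norm_num)
  rw [sum_bernWeight_mul_prod_ind, gibbs_sum, mul_one] at hdom
  refine hdom.trans (le_of_eq ?_)
  rw [mass_eq]
  refine Finset.sum_congr rfl fun x _ => ?_
  rw [Finset.prod_ite_zero, Finset.prod_const_one, boole_mul]
  congr

theorem gibbs_mass_forall_false_ge {H : (E → Bool) → ℝ} {B : ℝ}
    (hB : ∀ e x, discDeriv H e x ≤ B) (S : Finset E) :
    (1 - Phi B) ^ S.card ≤ mass (gibbs H) (fun x => ∀ e ∈ S, x e = false) := by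
  classical
  have hdom := sum_mul_le_bernWeight (Phi_pos B) (Phi_lt_one B) (gibbs H)
    (fun x => (gibbs_pos H x).le) (fun a e => by
      rw [gibbs_update_true]
      have h4 : (1 - Phi B) * Real.exp (discDeriv H e a) ≤ Phi B := by
        conv_rhs => rw [← one_sub_Phi_mul_exp B]
        exact mul_le_mul_of_nonneg_left (Real.exp_le_exp.mpr (hB e a))
          (sub_nonneg.mpr (Phi_lt_one _).le)
      have := mul_le_mul_of_nonneg_right h4 (gibbs_pos H (Function.update a e false)).le
      linarith)
    (fun x => 1 - ∏ e ∈ S, if x e = true then (0 : ℝ) else 1)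
    (fun x y hxy => sub_le_sub_left (Finset.prod_le_prod
      (fun e _ => by split_ifs <;> norm_num) fun e _ => by
      have := hxy e
      by_cases h : x e = true
      · have hy : y e = true := by rw [h] at this; exact top_le_iff.mp this
        simp [h, hy]
      · rw [if_neg h]; split_ifs <;> norm_num) 1)
    (fun x => sub_nonneg.mpr (Finset.prod_le_one (fun e _ => by split_ifs <;> norm_num)
      fun e _ => by split_ifs <;> norm_num))
  simp only [sub_mul, mul_sub, Finset.sum_sub_distrib, mul_one, one_mul] at hdom
  rw [sum_bernWeight_mul_prod_ind_false, gibbs_sum, bernWeight_sum] at hdom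
  have h2 : ∑ x, (∏ e ∈ S, if x e = true then (0 : ℝ) else 1) * gibbs H x =
      mass (gibbs H) (fun x => ∀ e ∈ S, x e = false) := by
    rw [mass_eq]
    refine Finset.sum_congr rfl fun x _ => ?_
    have h3 : ∀ e, (if x e = true then (0 : ℝ) else 1) = if x e = false then 1 else 0 := by
      intro e; cases x e <;> simp
    rw [Finset.prod_congr rfl fun e _ => h3 e, Finset.prod_ite_zero, Finset.prod_const_one,
      boole_mul]
    congr
  rw [h2] at hdom
  linarith

end Gibbs

section Discrepancy

variable {E : Type*} [Fintype E] [DecidableEq E]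

theorem monotoneOn_of_update {Γ : Set (E → Bool)} (hΓ : Γ.OrdConnected) {h : (E → Bool) → ℝ}
    (hloc : ∀ x e, Function.update x e false ∈ Γ → Function.update x e true ∈ Γ →
      h (Function.update x e false) ≤ h (Function.update x e true)) : MonotoneOn h Γ := by
  intro x hx y hy hxy
  have hmem : ∀ S : Finset E, S.piecewise y x ∈ Γ := fun S =>
    hΓ.out hx hy ⟨Finset.le_piecewise_of_le_of_le _ hxy le_rfl,
      Finset.piecewise_le_of_le_of_le _ le_rfl hxy⟩
  have key : ∀ S : Finset E, h x ≤ h (S.piecewise y x) := by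
    intro S
    induction S using Finset.induction_on with
    | empty => simp
    | insert e S he ih =>
      refine ih.trans ?_
      have hS := hmem S
      have hS' := hmem (insert e S)
      have hxe : S.piecewise y x e = x e := Finset.piecewise_eq_of_notMem _ _ _ he
      rw [Finset.piecewise_insert] at hS' ⊢
      have hle := hxy e
      cases hye : y e
      · rw [hye] at hle
        have : S.piecewise y x e = false := by rw [hxe]; exact le_bot_iff.mp hle
        rw [← this, Function.update_eq_self]
      · cases hxe' : x e
        · have h1 : Function.update (S.piecewise y x) e false = S.piecewise y x := by
            rw [← hxe', ← hxe, Function.update_eq_self]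
          rw [hye] at hS'
          have := hloc (S.piecewise y x) e (by rwa [h1]) hS'
          rwa [h1] at this
        · have : S.piecewise y x e = true := by rw [hxe]; exact hxe'
          rw [← this, Function.update_eq_self]
  simpa using key univ

/-- A weighted comparison of two ordered weights satisfying the single-site identities with
increasing local specifications that contract on an order-convex set `Γ`. -/
theorem weighted_discrepancy_le {μ₀ μ₁ : (E → Bool) → ℝ}
    (h₀ : ∀ x, 0 ≤ μ₀ x) (h₁ : ∀ x, 0 ≤ μ₁ x) (s₁ : ∑ x, μ₁ x = 1)
    (hmono : ∀ g : (E → Bool) → ℝ, Monotone g → ∑ x, μ₀ x * g x ≤ ∑ x, μ₁ x * g x)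
    {R : E → (E → Bool) → ℝ} (hRm : ∀ e, Monotone (R e)) (hR0 : ∀ e x, 0 ≤ R e x)
    (hR1 : ∀ e x, R e x ≤ 1) (I : Finset E)
    (ex₀ : ∀ e ∉ I, ∑ x, μ₀ x * (if x e = true then 1 else 0) = ∑ x, μ₀ x * R e x)
    (ex₁ : ∀ e ∉ I, ∑ x, μ₁ x * (if x e = true then 1 else 0) = ∑ x, μ₁ x * R e x)
    {w : E → ℝ} (hw : ∀ e, 0 ≤ w e) {ρ : ℝ} (hρ0 : 0 ≤ ρ) (hρ1 : ρ ≤ 1)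
    {Γ : Set (E → Bool)} (hΓ : Γ.OrdConnected)
    (hloc : ∀ x e', Function.update x e' false ∈ Γ → Function.update x e' true ∈ Γ →
      ∑ e, w e * discDeriv (R e) e' x ≤ ρ * w e') :
    (1 - ρ) * ∑ e ∈ Iᶜ, w e * (∑ x, μ₁ x * (if x e = true then 1 else 0) -
        ∑ x, μ₀ x * (if x e = true then 1 else 0)) ≤
      ρ * ∑ e ∈ I, w e +
        2 * (∑ e, w e) * (mass μ₁ (fun x => x ∉ Γ) + mass μ₀ (fun x => x ∉ Γ)) := by
  classical
  set W := ∑ e, w e with hW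
  set ind : E → (E → Bool) → ℝ := fun e x => if x e = true then 1 else 0 with hind
  have hind0 : ∀ e x, 0 ≤ ind e x := fun e x => by simp only [hind]; split_ifs <;> norm_num
  have hind1 : ∀ e x, ind e x ≤ 1 := fun e x => by simp only [hind]; split_ifs <;> norm_num
  have hW0 : 0 ≤ W := Finset.sum_nonneg fun e _ => hw e
  set h : (E → Bool) → ℝ := fun x => ρ * ∑ e, w e * ind e x - ∑ e ∈ Iᶜ, w e * R e x with hh
  have hle : ∀ x, h x ≤ W := fun x => by
    have a1 : ∑ e, w e * ind e x ≤ W :=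
      Finset.sum_le_sum fun e _ => mul_le_of_le_one_right (hw e) (hind1 e x)
    have a2 : 0 ≤ ∑ e, w e * ind e x := Finset.sum_nonneg fun e _ => mul_nonneg (hw e) (hind0 e x)
    have a3 : 0 ≤ ∑ e ∈ Iᶜ, w e * R e x :=
      Finset.sum_nonneg fun e _ => mul_nonneg (hw e) (hR0 e x)
    simp only [hh]
    nlinarith
  have hge : ∀ x, -W ≤ h x := fun x => by
    have a2 : 0 ≤ ∑ e, w e * ind e x := Finset.sum_nonneg fun e _ => mul_nonneg (hw e) (hind0 e x)
    have a3 : ∑ e ∈ Iᶜ, w e * R e x ≤ W :=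
      (Finset.sum_le_sum fun e _ => mul_le_of_le_one_right (hw e) (hR1 e x)).trans
        (Finset.sum_le_sum_of_subset_of_nonneg (Finset.subset_univ _) fun e _ _ => hw e)
    have := mul_nonneg hρ0 a2
    simp only [hh]
    linarith
  have hmonoOn : MonotoneOn h Γ := monotoneOn_of_update hΓ fun x e' hf ht => by
    have a1 : ∑ e, w e * ind e (Function.update x e' true) -
        ∑ e, w e * ind e (Function.update x e' false) = w e' := by
      rw [← Finset.sum_sub_distrib, Finset.sum_eq_single e']
      · simp [hind]
      · intro e _ hne
        simp [hind, hne]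
      · simp
    have a2 : ∑ e ∈ Iᶜ, w e * R e (Function.update x e' true) -
        ∑ e ∈ Iᶜ, w e * R e (Function.update x e' false) ≤ ρ * w e' := by
      rw [← Finset.sum_sub_distrib]
      refine le_trans (le_of_eq ?_) ((Finset.sum_le_sum_of_subset_of_nonneg
        (Finset.subset_univ Iᶜ) fun e _ _ => mul_nonneg (hw e) (sub_nonneg.mpr
          (hRm e (update_le_update_iff.mpr ⟨Bool.false_le _, fun _ _ => le_rfl⟩)))).trans
          (hloc x e' hf ht))
      exact Finset.sum_congr rfl fun e _ => by rw [mul_sub]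
    simp only [hh]
    have := congrArg (ρ * ·) a1
    simp only [mul_sub] at this
    linarith
  set g : (E → Bool) → ℝ := fun x =>
    univ.sup' univ_nonempty fun y => if y ∈ Γ ∧ y ≤ x then h y else -W with hg
  have hgm : Monotone g := fun x z hxz => by
    refine Finset.sup'_mono_fun fun y _ => ?_
    by_cases hy : y ∈ Γ ∧ y ≤ x
    · rw [if_pos hy, if_pos ⟨hy.1, hy.2.trans hxz⟩]
    · rw [if_neg hy]
      split_ifs
      · exact hge y
      · exact le_rfl
  have hgle : ∀ x, g x ≤ W := fun x => Finset.sup'_le _ _ fun y _ => by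
    split_ifs
    · exact hle y
    · linarith
  have hgge' : ∀ x y, (if y ∈ Γ ∧ y ≤ x then h y else -W) ≤ g x := fun x y =>
    Finset.le_sup' (fun y => if y ∈ Γ ∧ y ≤ x then h y else -W) (mem_univ y)
  have hgge : ∀ x, -W ≤ g x := fun x => by
    refine le_trans ?_ (hgge' x x)
    split_ifs
    · exact hge x
    · exact le_rfl
  have hgΓ : ∀ x ∈ Γ, g x = h x := fun x hx => by
    refine le_antisymm (Finset.sup'_le _ _ fun y _ => ?_) ?_
    · split_ifs with hy
      · exact hmonoOn hy.1 hx hy.2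
      · exact hge x
    · simpa [hx] using hgge' x x
  have herr : ∀ μ : (E → Bool) → ℝ, (∀ x, 0 ≤ μ x) →
      |∑ x, μ x * h x - ∑ x, μ x * g x| ≤ 2 * W * mass μ (fun x => x ∉ Γ) := by
    intro μ hμ
    rw [← Finset.sum_sub_distrib, mass_eq, Finset.mul_sum]
    refine (Finset.abs_sum_le_sum_abs _ _).trans (Finset.sum_le_sum fun x _ => ?_)
    by_cases hx : x ∈ Γ
    · simp [hgΓ x hx, hx]
    · rw [if_pos hx, ← mul_sub, abs_mul, abs_of_nonneg (hμ x), mul_comm]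
      refine mul_le_mul_of_nonneg_right ?_ (hμ x)
      rw [abs_le]
      constructor <;> linarith [hle x, hge x, hgle x, hgge x]
  have hval : ∀ μ : (E → Bool) → ℝ,
      (∀ e ∉ I, ∑ x, μ x * ind e x = ∑ x, μ x * R e x) →
      ∑ x, μ x * h x = ρ * ∑ e ∈ I, w e * ∑ x, μ x * ind e x -
        (1 - ρ) * ∑ e ∈ Iᶜ, w e * ∑ x, μ x * ind e x := by
    intro μ hμ
    have a1 : ∑ x, μ x * h x = ρ * ∑ e, w e * ∑ x, μ x * ind e x -
        ∑ e ∈ Iᶜ, w e * ∑ x, μ x * R e x := by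
      simp only [hh, mul_sub, Finset.sum_sub_distrib, Finset.mul_sum]
      congr 1
      · rw [Finset.sum_comm]
        exact Finset.sum_congr rfl fun e _ => Finset.sum_congr rfl fun x _ => by ring
      · rw [Finset.sum_comm]
        exact Finset.sum_congr rfl fun e _ => Finset.sum_congr rfl fun x _ => by ring
    have a2 : ∑ e ∈ Iᶜ, w e * ∑ x, μ x * R e x = ∑ e ∈ Iᶜ, w e * ∑ x, μ x * ind e x :=
      Finset.sum_congr rfl fun e he => by rw [hμ e (Finset.mem_compl.mp he)]
    rw [a1, a2, ← Finset.sum_add_sum_compl I]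
    ring
  have e0 := abs_le.mp (herr μ₀ h₀)
  have e1 := abs_le.mp (herr μ₁ h₁)
  have hcmp := hmono g hgm
  rw [hval μ₀ ex₀] at e0
  rw [hval μ₁ ex₁] at e1
  have hI : ∑ e ∈ I, w e * ∑ x, μ₁ x * ind e x - ∑ e ∈ I, w e * ∑ x, μ₀ x * ind e x ≤
      ∑ e ∈ I, w e := by
    rw [← Finset.sum_sub_distrib]
    refine Finset.sum_le_sum fun e _ => ?_
    have b1 : ∑ x, μ₁ x * ind e x ≤ 1 := by
      rw [← s₁]
      exact Finset.sum_le_sum fun x _ => mul_le_of_le_one_right (h₁ x) (hind1 e x)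
    have b0 : 0 ≤ ∑ x, μ₀ x * ind e x :=
      Finset.sum_nonneg fun x _ => mul_nonneg (h₀ x) (hind0 e x)
    nlinarith [hw e]
  have hI' := mul_le_mul_of_nonneg_left hI hρ0
  simp only [mul_sub, Finset.sum_sub_distrib] at hI' ⊢
  linarith [e0.1, e0.2, e1.1, e1.2]

end Discrepancy

section Pinned

variable {E : Type*} [Fintype E] [DecidableEq E]

theorem one_sub_Phi (t : ℝ) : 1 - Phi t = Phi (-t) := by
  unfold Phi
  have h1 : (1 + Real.exp t) ≠ 0 := by positivity
  have h2 : (1 + Real.exp (-t)) ≠ 0 := by positivity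
  rw [eq_div_iff h2, one_sub_div h1, div_mul_eq_mul_div, div_eq_iff h1]
  rw [show Real.exp (-t) * (1 + Real.exp t) = Real.exp (-t) + Real.exp (-t) * Real.exp t by ring,
    ← Real.exp_add]
  simp [add_comm]

/-- Stability of the conditional marginal of `j` in terms of weights that the linearised
single-site dynamics contracts on an order-convex set. -/
theorem gibbs_pinned_discrepancy {κ : Type*} [Fintype κ] {H : (E → Bool) → ℝ}
    (hH : Supermodular H) {i : κ → E} (hi : Function.Injective i) {j : E} (hj : ∀ t, i t ≠ j)
    {B : ℝ} (hB : ∀ e x, |discDeriv H e x| ≤ B) {w : E → ℝ} (hw : ∀ e, 0 ≤ w e) {ρ : ℝ}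
    (hρ0 : 0 ≤ ρ) (hρ1 : ρ ≤ 1) {Γ : Set (E → Bool)} (hΓ : Γ.OrdConnected)
    (hloc : ∀ x e', Function.update x e' false ∈ Γ → Function.update x e' true ∈ Γ →
      ∑ e, w e * discDeriv (fun x => Phi (discDeriv H e x)) e' x ≤ ρ * w e')
    (a b : κ → Bool) :
    (1 - ρ) * w j *
      |mass (gibbs H) (fun x => x j = true ∧ ∀ t, x (i t) = a t) /
          mass (gibbs H) (fun x => ∀ t, x (i t) = a t) -
        mass (gibbs H) (fun x => x j = true ∧ ∀ t, x (i t) = b t) /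
          mass (gibbs H) (fun x => ∀ t, x (i t) = b t)| ≤
      ρ * ∑ t, w (i t) +
        4 * (∑ e, w e) * (mass (gibbs H) (fun x => x ∉ Γ) / Phi (-B) ^ Fintype.card κ) := by
  classical
  have hg0 : ∀ x, 0 ≤ gibbs H x := fun x => (gibbs_pos H x).le
  set Z : (κ → Bool) → ℝ := fun a => mass (gibbs H) (fun x => ∀ t, x (i t) = a t) with hZ
  set P : E → (κ → Bool) → ℝ := fun e a =>
    ∑ x, gibbs H x * (if x e = true then 1 else 0) * (if ∀ t, x (i t) = a t then 1 else 0) with hP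
  have hPm : ∀ a, mass (gibbs H) (fun x => x j = true ∧ ∀ t, x (i t) = a t) = P j a := by
    intro a
    rw [mass_eq_sum_mul]
    refine Finset.sum_congr rfl fun x _ => ?_
    rw [mul_assoc]
    congr 1
    by_cases h1 : x j = true <;> by_cases h2 : ∀ t, x (i t) = a t <;> simp [h1, h2]
  have hZpos : ∀ a, 0 < Z a := by
    intro a
    have : gibbs H (Function.extend i a fun _ => false) ≤ Z a := by
      have h1 : ∀ t, Function.extend i a (fun _ => false) (i t) = a t := fun t =>
        hi.extend_apply _ _ _
      have h2 := Finset.single_le_sum (f := fun x => if ∀ t, x (i t) = a t then gibbs H x else 0)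
        (fun x _ => by split_ifs <;> simp [hg0 x])
        (mem_univ (Function.extend i a fun _ => false))
      simp only [if_pos h1] at h2
      simp only [hZ]
      rw [mass_eq]
      exact h2
    exact (gibbs_pos H _).trans_le this
  have hmonind : ∀ e : E, Monotone fun x : E → Bool => if x e = true then (1 : ℝ) else 0 := by
    intro e x y hxy
    have := hxy e
    by_cases h : x e = true
    · have hy : y e = true := by rw [h] at this; exact top_le_iff.mp this
      simp [h, hy]
    · simp only [if_neg h]; split_ifs <;> norm_num
  have hPle : ∀ {a b : κ → Bool}, a ≤ b → ∀ {g : (E → Bool) → ℝ}, Monotone g →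
      (∑ x, gibbs H x * g x * (if ∀ t, x (i t) = a t then 1 else 0)) / Z a ≤
      (∑ x, gibbs H x * g x * (if ∀ t, x (i t) = b t then 1 else 0)) / Z b := by
    intro a b hab g hg
    rw [div_le_div_iff₀ (hZpos a) (hZpos b)]
    convert gibbs_sum_pinned_le hH i hab hg
    rfl
  set I : Finset E := univ.image i with hI
  have hIcard : I.card = Fintype.card κ := by
    rw [hI, Finset.card_image_of_injective _ hi, Finset.card_univ]
  have hBall : ∀ e x, -B ≤ discDeriv H e x ∧ discDeriv H e x ≤ B := fun e x => abs_le.mp (hB e x)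
  have hZ1 : Phi (-B) ^ Fintype.card κ ≤ Z fun _ => true := by
    have := gibbs_mass_forall_true_ge (fun e x => (hBall e x).1) I
    rw [hIcard] at this
    refine this.trans (mass_mono hg0 fun x hx t => hx _ (Finset.mem_image_of_mem i (mem_univ t)))
  have hZ0 : Phi (-B) ^ Fintype.card κ ≤ Z fun _ => false := by
    have := gibbs_mass_forall_false_ge (fun e x => (hBall e x).2) I
    rw [hIcard, one_sub_Phi] at this
    refine this.trans (mass_mono hg0 fun x hx t => hx _ (Finset.mem_image_of_mem i (mem_univ t)))
  set μ : Bool → (E → Bool) → ℝ := fun b x =>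
    gibbs H x * (if ∀ t, x (i t) = b then 1 else 0) / Z fun _ => b with hμ
  have hμ0 : ∀ b x, 0 ≤ μ b x := fun b x =>
    div_nonneg (mul_nonneg (hg0 x) (by split_ifs <;> norm_num)) (hZpos _).le
  have hμg : ∀ b (g : (E → Bool) → ℝ), ∑ x, μ b x * g x =
      (∑ x, gibbs H x * g x * (if ∀ t, x (i t) = b then 1 else 0)) / Z fun _ => b := by
    intro b g
    rw [Finset.sum_div]
    exact Finset.sum_congr rfl fun x _ => by simp only [hμ]; ring
  have hμs : ∀ b, ∑ x, μ b x = 1 := by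
    intro b
    have h1 := hμg b fun _ => 1
    simp only [mul_one] at h1
    rw [h1]
    refine div_eq_one_iff_eq (hZpos _).ne' |>.mpr ?_
    simp only [hZ]
    rw [mass_eq_sum_mul]
  have hμΓ : ∀ b, Phi (-B) ^ Fintype.card κ ≤ Z (fun _ => b) →
      mass (μ b) (fun x => x ∉ Γ) ≤ mass (gibbs H) (fun x => x ∉ Γ) / Phi (-B) ^ Fintype.card κ := by
    intro b hb
    refine le_trans ?_ (div_le_div_of_nonneg_left (mass_nonneg hg0 _)
      (pow_pos (Phi_pos _) _) hb)
    rw [mass_eq, mass_eq, Finset.sum_div]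
    refine Finset.sum_le_sum fun x _ => ?_
    by_cases hx : x ∉ Γ
    · rw [if_pos hx, if_pos hx]
      exact div_le_div_of_nonneg_right (mul_le_of_le_one_right (hg0 x) (by split_ifs <;> norm_num))
        (hZpos _).le
    · rw [if_neg hx, if_neg hx, zero_div]
  have hex : ∀ b, ∀ e ∉ I, ∑ x, μ b x * (if x e = true then 1 else 0) =
      ∑ x, μ b x * Phi (discDeriv H e x) := by
    intro b e he
    rw [hμg, hμg]
    congr 1
    have := gibbs_sum_pinned_apply H i (fun _ => b) e fun t ht =>
      he (Finset.mem_image.mpr ⟨t, mem_univ t, ht⟩)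
    convert this
  have hmain := weighted_discrepancy_le (hμ0 false) (hμ0 true) (hμs true)
    (fun g hg => by rw [hμg, hμg]; exact hPle (fun _ => Bool.false_le _) hg)
    (R := fun e x => Phi (discDeriv H e x))
    (fun e => Phi_monotone.comp (hH.monotone_discDeriv e)) (fun e x => (Phi_pos _).le)
    (fun e x => (Phi_lt_one _).le) I (hex false) (hex true) hw hρ0 hρ1 hΓ hloc
  have hd : ∀ e, 0 ≤ ∑ x, μ true x * (if x e = true then 1 else 0) -
      ∑ x, μ false x * (if x e = true then 1 else 0) := fun e => by
    rw [hμg, hμg]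
    exact sub_nonneg.mpr (hPle (fun _ => Bool.false_le _) (hmonind e))
  have hjI : j ∈ Iᶜ := by
    rw [Finset.mem_compl, hI, Finset.mem_image]
    rintro ⟨t, -, ht⟩
    exact hj t ht
  have hone := Finset.single_le_sum (fun e _ => mul_nonneg (hw e) (hd e)) hjI
  have hsumI : ∑ e ∈ I, w e = ∑ t, w (i t) := by
    rw [hI, Finset.sum_image fun x _ y _ h => hi h]
  have hW : 0 ≤ ∑ e, w e := Finset.sum_nonneg fun e _ => hw e
  have hbad := mul_le_mul_of_nonneg_left (add_le_add (hμΓ true hZ1) (hμΓ false hZ0))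
    (mul_nonneg zero_le_two hW)
  have hlow : ∀ a, P j (fun _ => false) / Z (fun _ => false) ≤ P j a / Z a := fun a =>
    hPle (fun _ => Bool.false_le _) (hmonind j)
  have hupp : ∀ a, P j a / Z a ≤ P j (fun _ => true) / Z (fun _ => true) := fun a =>
    hPle (fun _ => Bool.le_true _) (hmonind j)
  have habs : |P j a / Z a - P j b / Z b| ≤ P j (fun _ => true) / Z (fun _ => true) -
      P j (fun _ => false) / Z (fun _ => false) := by
    rw [abs_le]
    constructor <;> linarith [hlow a, hlow b, hupp a, hupp b]
  rw [hPm, hPm]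
  have hone' := mul_le_mul_of_nonneg_left hone (sub_nonneg.mpr hρ1)
  have habs' := mul_le_mul_of_nonneg_left habs (mul_nonneg (sub_nonneg.mpr hρ1) (hw j))
  rw [hμg, hμg] at hone'
  simp only [hP] at habs' ⊢
  rw [hsumI] at hmain
  linarith

end Pinned

section Polynomial

variable {E : Type*} [DecidableEq E]

/-- The indicator that all edges of `S` are present, as a monomial. -/
noncomputable def monomial (S : Finset E) (x : E → Bool) : ℝ :=
  ∏ e ∈ S, if x e = true then 1 else 0

omit [DecidableEq E] in
theorem monomial_eq (S : Finset E) (x : E → Bool) [Decidable (∀ e ∈ S, x e = true)] :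
    monomial S x = if ∀ e ∈ S, x e = true then 1 else 0 := by
  rw [monomial, Finset.prod_ite_zero, Finset.prod_const_one]
  congr

omit [DecidableEq E] in
theorem monomial_nonneg (S : Finset E) (x : E → Bool) : 0 ≤ monomial S x :=
  Finset.prod_nonneg fun e _ => by split_ifs <;> norm_num

omit [DecidableEq E] in
theorem monomial_le_one (S : Finset E) (x : E → Bool) : monomial S x ≤ 1 :=
  Finset.prod_le_one (fun e _ => by split_ifs <;> norm_num) fun e _ => by split_ifs <;> norm_num

omit [DecidableEq E] in
theorem monomial_monotone (S : Finset E) : Monotone (monomial S) := by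
  classical
  intro x y hxy
  rw [monomial_eq, monomial_eq]
  by_cases h : ∀ e ∈ S, x e = true
  · have hy : ∀ e ∈ S, y e = true := fun e he => by
      have := hxy e
      rw [h e he] at this
      exact top_le_iff.mp this
    rw [if_pos h, if_pos hy]
  · rw [if_neg h]
    split_ifs <;> norm_num

theorem discDeriv_monomial (S : Finset E) (e : E) (x : E → Bool) :
    discDeriv (monomial S) e x = if e ∈ S then monomial (S.erase e) x else 0 := by
  have hup : ∀ T : Finset E, e ∉ T → ∀ b, monomial T (Function.update x e b) = monomial T x :=
    fun T hT b => Finset.prod_congr rfl fun e' he' => by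
      rw [Function.update_of_ne (ne_of_mem_of_not_mem he' hT)]
  by_cases he : e ∈ S
  · have h : ∀ b, monomial S (Function.update x e b) =
        (if b = true then 1 else 0) * monomial (S.erase e) x := fun b => by
      rw [← hup _ (Finset.notMem_erase e S) b, monomial, ← Finset.mul_prod_erase S _ he,
        Function.update_self, monomial]
    rw [discDeriv, h, h, if_pos he]
    simp
  · rw [discDeriv, hup S he, hup S he, if_neg he, sub_self]

omit [DecidableEq E] in
theorem supermodular_monomial (S : Finset E) : Supermodular (monomial S) := by
  classical
  intro a b
  have h1 := monomial_monotone S (le_sup_left : a ≤ a ⊔ b)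
  have h2 := monomial_monotone S (le_sup_right : b ≤ a ⊔ b)
  have h3 := monomial_nonneg S (a ⊓ b)
  by_cases ha : ∀ e ∈ S, a e = true
  · by_cases hb : ∀ e ∈ S, b e = true
    · have hab : ∀ e ∈ S, (a ⊓ b) e = true := fun e he => by
        rw [Pi.inf_apply, ha e he, hb e he]; rfl
      have : monomial S (a ⊓ b) = 1 := by rw [monomial_eq, if_pos hab]
      have := monomial_le_one S a
      linarith
    · have : monomial S b = 0 := by rw [monomial_eq, if_neg hb]
      linarith
  · have : monomial S a = 0 := by rw [monomial_eq, if_neg ha]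
    linarith

variable {K : Type*} [Fintype K]

/-- A linear combination of monomials. -/
noncomputable def poly (c : K → ℝ) (S : K → Finset E) (x : E → Bool) : ℝ :=
  ∑ k, c k * monomial (S k) x

omit [DecidableEq E] in
theorem poly_nonneg {c : K → ℝ} (hc : ∀ k, 0 ≤ c k) (S : K → Finset E) (x : E → Bool) :
    0 ≤ poly c S x :=
  Finset.sum_nonneg fun k _ => mul_nonneg (hc k) (monomial_nonneg _ _)

omit [DecidableEq E] in
theorem poly_le {c : K → ℝ} (hc : ∀ k, 0 ≤ c k) (S : K → Finset E) (x : E → Bool) :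
    poly c S x ≤ ∑ k, c k :=
  Finset.sum_le_sum fun k _ => mul_le_of_le_one_right (hc k) (monomial_le_one _ _)

omit [DecidableEq E] in
theorem poly_monotone {c : K → ℝ} (hc : ∀ k, 0 ≤ c k) (S : K → Finset E) : Monotone (poly c S) :=
  fun _ _ hxy => Finset.sum_le_sum fun k _ =>
    mul_le_mul_of_nonneg_left (monomial_monotone _ hxy) (hc k)

theorem discDeriv_poly (c : K → ℝ) (S : K → Finset E) (e : E) :
    discDeriv (poly c S) e =
      poly (fun k => if e ∈ S k then c k else 0) fun k => (S k).erase e := by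
  funext x
  have : discDeriv (poly c S) e x = ∑ k, c k * discDeriv (monomial (S k)) e x := by
    simp only [discDeriv, poly, mul_sub, Finset.sum_sub_distrib]
  rw [this, poly]
  refine Finset.sum_congr rfl fun k _ => ?_
  rw [discDeriv_monomial]
  split_ifs <;> simp

omit [DecidableEq E] in
theorem supermodular_poly {c : K → ℝ} (hc : ∀ k, 0 ≤ c k) (S : K → Finset E) :
    Supermodular (poly c S) := by
  intro a b
  simp only [poly]
  rw [← Finset.sum_add_distrib, ← Finset.sum_add_distrib]
  refine Finset.sum_le_sum fun k _ => ?_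
  have := mul_le_mul_of_nonneg_left (supermodular_monomial (S k) a b) (hc k)
  linarith

theorem sum_bernWeight_poly [Fintype E] (q : ℝ) (c : K → ℝ) (S : K → Finset E) :
    ∑ x, bernWeight q x * poly c S x = ∑ k, c k * q ^ (S k).card := by
  simp only [poly, Finset.mul_sum]
  rw [Finset.sum_comm]
  refine Finset.sum_congr rfl fun k _ => ?_
  rw [← sum_bernWeight_mul_prod_ind q (S k), Finset.mul_sum]
  exact Finset.sum_congr rfl fun x _ => by rw [monomial]; ring

/-- The total coefficient of the monomials containing both `e` and `e'`. -/
noncomputable def pairWeight (c : K → ℝ) (S : K → Finset E) (e e' : E) : ℝ :=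
  ∑ k, if e ∈ S k ∧ e' ∈ S k ∧ e ≠ e' then c k else 0

theorem discDeriv_poly_nonneg {c : K → ℝ} (hc : ∀ k, 0 ≤ c k) (S : K → Finset E) (e : E)
    (x : E → Bool) : 0 ≤ discDeriv (poly c S) e x := by
  rw [discDeriv_poly]
  exact poly_nonneg (fun k => by split_ifs <;> simp [hc k]) _ _

theorem discDeriv_poly_le {c : K → ℝ} (hc : ∀ k, 0 ≤ c k) (S : K → Finset E) (e : E)
    (x : E → Bool) : discDeriv (poly c S) e x ≤ ∑ k, if e ∈ S k then c k else 0 := by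
  rw [discDeriv_poly]
  exact poly_le (fun k => by split_ifs <;> simp [hc k]) _ _

theorem discDeriv_discDeriv_poly_nonneg {c : K → ℝ} (hc : ∀ k, 0 ≤ c k) (S : K → Finset E)
    (e e' : E) (x : E → Bool) : 0 ≤ discDeriv (discDeriv (poly c S) e) e' x := by
  rw [discDeriv_poly]
  exact discDeriv_poly_nonneg (fun k => by split_ifs <;> simp [hc k]) _ _ _

theorem discDeriv_discDeriv_poly_le {c : K → ℝ} (hc : ∀ k, 0 ≤ c k) (S : K → Finset E)
    (e e' : E) (x : E → Bool) :
    discDeriv (discDeriv (poly c S) e) e' x ≤ pairWeight c S e e' := by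
  rw [discDeriv_poly]
  refine (discDeriv_poly_le (fun k => by split_ifs <;> simp [hc k]) _ _ _).trans (le_of_eq ?_)
  refine Finset.sum_congr rfl fun k _ => ?_
  rw [← ite_and]
  congr 1
  rw [eq_iff_iff, Finset.mem_erase, ne_comm]
  tauto

theorem sum_bernWeight_discDeriv_poly [Fintype E] (q : ℝ) (c : K → ℝ) (S : K → Finset E) (e : E) :
    ∑ x, bernWeight q x * discDeriv (poly c S) e x =
      ∑ k, if e ∈ S k then c k * q ^ ((S k).card - 1) else 0 := by
  rw [discDeriv_poly, sum_bernWeight_poly]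
  refine Finset.sum_congr rfl fun k _ => ?_
  split_ifs with h
  · rw [Finset.card_erase_of_mem h]
  · simp

variable [Fintype E]

/-- The total second-order interaction of the coordinate `e` with all others. -/
def interaction (H : (E → Bool) → ℝ) (e : E) (x : E → Bool) : ℝ :=
  ∑ e', discDeriv (discDeriv H e) e' x

theorem interaction_poly_monotone {c : K → ℝ} (hc : ∀ k, 0 ≤ c k) (S : K → Finset E) (e : E) :
    Monotone (interaction (poly c S) e) := by
  intro x y hxy
  refine Finset.sum_le_sum fun e' _ => ?_
  rw [discDeriv_poly, discDeriv_poly]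
  exact poly_monotone (fun k => by split_ifs <;> simp [hc k]) _ hxy

theorem abs_discDeriv_interaction_poly_le {c : K → ℝ} (hc : ∀ k, 0 ≤ c k) (S : K → Finset E)
    {L : ℕ} (hL : ∀ k, (S k).card ≤ L) (e f : E) (x : E → Bool) :
    |discDeriv (interaction (poly c S) e) f x| ≤ L * pairWeight c S e f := by
  have h1 : discDeriv (interaction (poly c S) e) f x =
      ∑ e', discDeriv (discDeriv (discDeriv (poly c S) e) e') f x := by
    simp only [interaction, discDeriv, Finset.sum_sub_distrib]
  have h2 : 0 ≤ discDeriv (interaction (poly c S) e) f x := by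
    rw [h1]
    refine Finset.sum_nonneg fun e' _ => ?_
    rw [discDeriv_poly]
    exact discDeriv_discDeriv_poly_nonneg (fun k => by split_ifs <;> simp [hc k]) _ _ _ _
  rw [abs_of_nonneg h2, h1]
  calc ∑ e', discDeriv (discDeriv (discDeriv (poly c S) e) e') f x
      ≤ ∑ e', ∑ k, (if e' ∈ S k then 1 else 0) *
          (if e ∈ S k ∧ f ∈ S k ∧ e ≠ f then c k else 0) := by
        refine Finset.sum_le_sum fun e' _ => ?_
        rw [discDeriv_poly]
        refine (discDeriv_discDeriv_poly_le (fun k => by split_ifs <;> simp [hc k])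
          _ _ _ _).trans (Finset.sum_le_sum fun k _ => ?_)
        simp only [Finset.mem_erase]
        by_cases h : e ∈ S k ∧ f ∈ S k ∧ e ≠ f
        · rw [if_pos h, if_pos h.1]
          by_cases h' : e' ∈ S k
          · rw [if_pos h', one_mul]
            split_ifs
            · exact le_rfl
            · exact hc k
          · rw [if_neg h', zero_mul, if_neg (by tauto)]
        · rw [if_neg h, mul_zero]
          by_cases he : e ∈ S k
          · rw [if_neg]
            rintro ⟨⟨-, -⟩, ⟨hfe, hf⟩, -⟩
            exact h ⟨he, hf, hfe.symm⟩
          · rw [if_neg he]; split_ifs <;> rfl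
    _ = ∑ k, ((S k).card : ℝ) * (if e ∈ S k ∧ f ∈ S k ∧ e ≠ f then c k else 0) := by
        rw [Finset.sum_comm]
        refine Finset.sum_congr rfl fun k _ => ?_
        rw [← Finset.sum_mul]
        congr 1
        simp
    _ ≤ L * pairWeight c S e f := by
        rw [pairWeight, Finset.mul_sum]
        refine Finset.sum_le_sum fun k _ => mul_le_mul_of_nonneg_right (by exact_mod_cast hL k) ?_
        split_ifs
        · exact hc k
        · exact le_rfl

theorem sum_bernWeight_interaction_poly (q : ℝ) (c : K → ℝ) (S : K → Finset E) (e : E) :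
    ∑ x, bernWeight q x * interaction (poly c S) e x =
      ∑ k, if e ∈ S k then c k * (((S k).card - 1 : ℕ) * q ^ ((S k).card - 2)) else 0 := by
  simp only [interaction, Finset.mul_sum]
  rw [Finset.sum_comm]
  simp only [discDeriv_poly c S e, sum_bernWeight_discDeriv_poly]
  rw [Finset.sum_comm]
  refine Finset.sum_congr rfl fun k _ => ?_
  rw [← Finset.sum_filter, Finset.filter_mem_eq_inter, Finset.univ_inter, Finset.sum_const]
  split_ifs with h
  · rw [Finset.card_erase_of_mem h, nsmul_eq_mul, Nat.sub_sub]
    ring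
  · simp

end Polynomial

section Counting

variable {n m : ℕ}

open scoped Classical in
/-- The edges of the copy of `G` in `K_n` placed by the injection `ψ`. -/
noncomputable def copyEdges (G : SimpleGraph (Fin m)) (ψ : Fin m ↪ Fin n) : Finset (EdgeSet n) :=
  {e | e.1 ∈ Sym2.map ψ '' G.edgeSet}

theorem mem_copyEdges {G : SimpleGraph (Fin m)} {ψ : Fin m ↪ Fin n} {e : EdgeSet n} :
    e ∈ copyEdges G ψ ↔ e.1 ∈ Sym2.map ψ '' G.edgeSet := by
  simp [copyEdges]

theorem card_copyEdges (G : SimpleGraph (Fin m)) (ψ : Fin m ↪ Fin n) :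
    (copyEdges G ψ).card = numEdges G := by
  rw [numEdges, ← Set.ncard_image_of_injective _ (Sym2.map.injective ψ.injective),
    ← Set.ncard_coe_finset, ← Set.ncard_image_of_injective _ Subtype.val_injective]
  congr 1
  ext z
  constructor
  · rintro ⟨e, he, rfl⟩
    exact mem_copyEdges.mp he
  · intro hz
    refine ⟨⟨z, ?_⟩, mem_copyEdges.mpr hz, rfl⟩
    obtain ⟨y, hy, rfl⟩ := hz
    rw [Sym2.isDiag_map ψ.injective]
    exact G.not_isDiag_of_mem_edgeSet hy

theorem prod_edgeInd_eq_monomial (G : SimpleGraph (Fin m)) (ψ : Fin m ↪ Fin n) (x : Config n) :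
    (∏ a : Fin m, ∏ b : Fin m,
      (open scoped Classical in if G.Adj a b then edgeInd x (ψ a) (ψ b) else 1)) =
      monomial (copyEdges G ψ) x := by
  classical
  have hval : ∀ a b (hab : G.Adj a b) (h : ¬ (s(ψ a, ψ b)).IsDiag),
      edgeInd x (ψ a) (ψ b) = if x ⟨s(ψ a, ψ b), h⟩ = true then 1 else 0 := by
    intro a b _ h
    simp only [edgeInd, edgeVal, dif_neg h]
  have hdiag : ∀ a b, G.Adj a b → ¬ (s(ψ a, ψ b)).IsDiag := by
    intro a b hab
    rw [Sym2.mk_isDiag_iff]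
    exact fun h => hab.ne (ψ.injective h)
  rw [monomial_eq]
  split_ifs with h
  · refine Finset.prod_eq_one fun a _ => Finset.prod_eq_one fun b _ => ?_
    split_ifs with hab
    · rw [hval a b hab (hdiag a b hab), if_pos]
      exact h _ (mem_copyEdges.mpr ⟨s(a, b), hab, rfl⟩)
    · rfl
  · push Not at h
    obtain ⟨e, he, hx⟩ := h
    obtain ⟨y, hy, hye⟩ := mem_copyEdges.mp he
    induction y with
    | h a b =>
      have hab : G.Adj a b := hy
      refine Finset.prod_eq_zero (mem_univ a) (Finset.prod_eq_zero (mem_univ b) ?_)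
      have hd := hdiag a b hab
      have : e = ⟨s(ψ a, ψ b), hd⟩ := Subtype.ext hye.symm
      rw [if_pos hab, hval a b hab hd, ← this, if_neg hx]

theorem exists_perm_map_edge (e e' : EdgeSet n) :
    ∃ σ : Equiv.Perm (Fin n), Sym2.map σ e.1 = e'.1 := by
  obtain ⟨z, hz⟩ := e
  obtain ⟨z', hz'⟩ := e'
  induction z with
  | h a b =>
  induction z' with
  | h c d =>
  rw [Sym2.mk_isDiag_iff] at hz hz'
  have hb : Equiv.swap a c b ≠ c := by
    intro h
    apply hz
    have h' := congrArg (Equiv.swap a c) h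
    rw [Equiv.swap_apply_self, Equiv.swap_apply_right] at h'
    exact h'.symm
  refine ⟨Equiv.swap (Equiv.swap a c b) d * Equiv.swap a c, ?_⟩
  simp only [Sym2.map_mk, Equiv.Perm.mul_apply, Equiv.swap_apply_left]
  rw [Equiv.swap_apply_of_ne_of_ne hb.symm hz']

open scoped Classical in
theorem card_filter_mem_copyEdges (G : SimpleGraph (Fin m)) (e e' : EdgeSet n) :
    #{ψ : Fin m ↪ Fin n | e ∈ copyEdges G ψ} = #{ψ : Fin m ↪ Fin n | e' ∈ copyEdges G ψ} := by
  obtain ⟨σ, hσ⟩ := exists_perm_map_edge e e'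
  refine Finset.card_equiv (Equiv.embeddingCongr (Equiv.refl _) σ) fun ψ => ?_
  have h : ⇑((Equiv.embeddingCongr (Equiv.refl (Fin m)) σ) ψ) = σ ∘ ψ := by
    funext a; simp [Equiv.embeddingCongr]
  simp only [Finset.mem_filter, Finset.mem_univ, true_and, mem_copyEdges, h, ← hσ]
  constructor
  · rintro ⟨y, hy, hye⟩
    exact ⟨y, hy, by rw [← hye, Sym2.map_map]⟩
  · rintro ⟨y, hy, hye⟩
    refine ⟨y, hy, Sym2.map.injective σ.injective ?_⟩
    rw [← hye, Sym2.map_map]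

open scoped Classical in
theorem card_filter_mem_copyEdges_mul (G : SimpleGraph (Fin m)) (e : EdgeSet n) :
    #{ψ : Fin m ↪ Fin n | e ∈ copyEdges G ψ} * n.choose 2 = numEdges G * n.descFactorial m := by
  have h1 : ∑ e' : EdgeSet n, #{ψ : Fin m ↪ Fin n | e' ∈ copyEdges G ψ} =
      ∑ ψ : Fin m ↪ Fin n, #{e' : EdgeSet n | e' ∈ copyEdges G ψ} := by
    simp only [Finset.card_filter]
    exact Finset.sum_comm
  have h2 : ∀ ψ : Fin m ↪ Fin n, #{e' : EdgeSet n | e' ∈ copyEdges G ψ} = numEdges G := by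
    intro ψ
    rw [Finset.filter_mem_eq_inter, Finset.univ_inter, card_copyEdges]
  rw [Finset.sum_congr rfl fun e' _ => card_filter_mem_copyEdges G e' e,
    Finset.sum_congr rfl fun ψ _ => h2 ψ, Finset.sum_const, Finset.sum_const, Finset.card_univ,
    Finset.card_univ, Fintype.card_embedding_eq] at h1
  have h3 : Fintype.card (EdgeSet n) = n.choose 2 := by
    have := Sym2.card_subtype_not_diag (α := Fin n)
    rw [Fintype.card_fin] at this
    rw [← this]
  rw [h3, smul_eq_mul, smul_eq_mul, Fintype.card_fin, Fintype.card_fin] at h1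
  rw [mul_comm, h1, mul_comm]

theorem two_le_of_edge (e : EdgeSet n) : 2 ≤ n := by
  obtain ⟨z, hz⟩ := e
  induction z with
  | h a b =>
  rw [Sym2.mk_isDiag_iff] at hz
  have h := Fintype.one_lt_card_iff.mpr ⟨a, b, hz⟩
  rwa [Fintype.card_fin] at h

theorem two_le_of_numEdges_pos {G : SimpleGraph (Fin m)} (h : numEdges G ≠ 0) : 2 ≤ m := by
  obtain ⟨z, hz⟩ := Set.nonempty_of_ncard_ne_zero h
  exact two_le_of_edge ⟨z, G.not_isDiag_of_mem_edgeSet hz⟩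

open scoped Classical in
theorem card_filter_mem_copyEdges_eq (G : SimpleGraph (Fin m)) (e : EdgeSet n) :
    #{ψ : Fin m ↪ Fin n | e ∈ copyEdges G ψ} =
      2 * numEdges G * (n - 2).descFactorial (m - 2) := by
  have h := card_filter_mem_copyEdges_mul G e
  obtain ⟨n, rfl⟩ : ∃ n', n = n' + 2 := ⟨n - 2, by have := two_le_of_edge e; omega⟩
  have hch : (n + 2).choose 2 * 2 = (n + 2) * (n + 1) := by
    have h := Nat.add_one_mul_choose_eq (n + 1) 1
    rw [Nat.choose_one_right] at h
    exact h.symm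
  rcases eq_or_ne (numEdges G) 0 with h0 | h0
  · rw [h0] at h ⊢
    simp only [zero_mul, mul_eq_zero, mul_zero] at h ⊢
    rcases h with h | h
    · exact h
    · rw [h] at hch; simp at hch
  · obtain ⟨m, rfl⟩ : ∃ m', m = m' + 2 := ⟨m - 2, by have := two_le_of_numEdges_pos h0; omega⟩
    rw [Nat.succ_descFactorial_succ, Nat.succ_descFactorial_succ] at h
    simp only [Nat.add_sub_cancel]
    have hpos : 0 < (n + 2) * (n + 1) := by positivity
    refine Nat.eq_of_mul_eq_mul_right hpos ?_
    rw [← hch, ← mul_assoc, h, hch]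
    ring

theorem descFactorial_le_mul_pow :
    (((n - 2).descFactorial (m - 2) : ℕ) : ℝ) ≤ (n : ℝ) ^ (m - 2) := by
  have h := (Nat.descFactorial_le_pow (n - 2) (m - 2)).trans
    (Nat.pow_le_pow_left (Nat.sub_le n 2) (m - 2))
  exact_mod_cast h

theorem mul_pow_le_descFactorial (hm : 2 ≤ m) (hn : m ≤ n) :
    (1 - (m : ℝ) ^ 2 / n) * (n : ℝ) ^ (m - 2) ≤ (((n - 2).descFactorial (m - 2) : ℕ) : ℝ) := by
  have hn0 : (0 : ℝ) < n := by exact_mod_cast (by omega : 0 < n)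
  have hmn : (m : ℝ) ≤ n := by exact_mod_cast hn
  have h1 : (n - m) ^ (m - 2) ≤ (n - 2).descFactorial (m - 2) :=
    (Nat.pow_le_pow_left (by omega) _).trans (Nat.pow_sub_le_descFactorial (n - 2) (m - 2))
  have h2 : ((n : ℝ) - m) ^ (m - 2) ≤ (((n - 2).descFactorial (m - 2) : ℕ) : ℝ) := by
    rw [← Nat.cast_sub hn]
    exact_mod_cast h1
  refine le_trans ?_ h2
  have hq : (m : ℝ) / n ≤ 1 := (div_le_one hn0).mpr hmn
  have hb := one_add_mul_le_pow (a := -((m : ℝ) / n)) (by linarith) (m - 2)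
  have h3 : (n : ℝ) - m = (1 + -((m : ℝ) / n)) * n := by field_simp; ring
  rw [h3, mul_pow]
  refine mul_le_mul_of_nonneg_right (le_trans ?_ hb) (by positivity)
  have h4 : ((m - 2 : ℕ) : ℝ) ≤ m := by exact_mod_cast Nat.sub_le m 2
  have h5 : ((m - 2 : ℕ) : ℝ) * ((m : ℝ) / n) ≤ m * ((m : ℝ) / n) :=
    mul_le_mul_of_nonneg_right h4 (by positivity)
  have h6 : (m : ℝ) ^ 2 / n = m * ((m : ℝ) / n) := by ring
  linarith

open scoped Classical in
theorem card_filter_cover_le (T : Finset (Fin n)) :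
    #{ψ : Fin m ↪ Fin n | ∀ v ∈ T, ∃ a, ψ a = v} ≤ m ^ T.card * n ^ (m - T.card) := by
  have hsub : ({ψ : Fin m ↪ Fin n | ∀ v ∈ T, ∃ a, ψ a = v} : Finset (Fin m ↪ Fin n)) ⊆
      (univ : Finset (T → Fin m)).biUnion fun g =>
        ({ψ : Fin m ↪ Fin n | ∀ v : T, ψ (g v) = v} : Finset (Fin m ↪ Fin n)) := by
    intro ψ hψ
    simp only [Finset.mem_filter, Finset.mem_univ, true_and, Finset.mem_biUnion] at hψ ⊢
    choose g hg using hψ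
    exact ⟨fun v => g v.1 v.2, fun v => hg v.1 v.2⟩
  refine (Finset.card_le_card hsub).trans ((Finset.card_biUnion_le_card_mul _ _
    (n ^ (m - T.card)) fun g _ => ?_).trans (le_of_eq ?_))
  · rcases Finset.eq_empty_or_nonempty
      ({ψ : Fin m ↪ Fin n | ∀ v : T, ψ (g v) = v} : Finset (Fin m ↪ Fin n)) with h | ⟨ψ₀, hψ₀⟩
    · rw [h]; simp
    · simp only [Finset.mem_filter, Finset.mem_univ, true_and] at hψ₀
      have hg : Function.Injective g := fun v w hvw => Subtype.ext (by
        rw [← hψ₀ v, ← hψ₀ w, hvw])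
      have hcard : Fintype.card {a : Fin m // ¬ a ∈ Set.range g} = m - T.card := by
        rw [Fintype.card_subtype_compl, Fintype.card_fin]
        congr 1
        have := Set.card_range_of_injective hg
        rw [Fintype.card_coe] at this
        exact this
      calc _ ≤ #(univ : Finset ({a : Fin m // ¬ a ∈ Set.range g} → Fin n)) := by
            refine Finset.card_le_card_of_injOn (fun ψ a => ψ a.1) (fun _ _ => by simp) ?_
            intro ψ hψ ψ' hψ' h
            simp only [Finset.coe_filter, Finset.mem_univ, true_and, Set.mem_ofPred_eq] at hψ hψ'
            refine DFunLike.ext _ _ fun a => ?_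
            by_cases ha : a ∈ Set.range g
            · obtain ⟨v, rfl⟩ := ha
              rw [hψ, hψ']
            · exact congrFun h ⟨a, ha⟩
        _ = _ := by
            rw [Finset.card_univ, Fintype.card_fun, Fintype.card_fin, hcard]
  · rw [Finset.card_univ, Fintype.card_fun, Fintype.card_fin, Fintype.card_coe]

open scoped Classical in
theorem card_filter_cover_div_le (hn : 0 < n) (T : Finset (Fin n)) {r : ℕ}
    (hT : T.card = r + 2) (hr : r ≤ 2) :
    (#{ψ : Fin m ↪ Fin n | ∀ v ∈ T, ∃ a, ψ a = v} : ℝ) / (n : ℝ) ^ (m - 2) ≤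
      (m : ℝ) ^ 4 / (n : ℝ) ^ r := by
  have hn0 : (0 : ℝ) < n := by exact_mod_cast hn
  rcases Finset.eq_empty_or_nonempty
      ({ψ : Fin m ↪ Fin n | ∀ v ∈ T, ∃ a, ψ a = v} : Finset (Fin m ↪ Fin n)) with h | ⟨ψ, hψ⟩
  · rw [h]; simp only [Finset.card_empty, Nat.cast_zero, zero_div]; positivity
  · simp only [Finset.mem_filter, Finset.mem_univ, true_and] at hψ
    have hTm : T.card ≤ m := by
      have hs : T ⊆ univ.image ψ := fun v hv => by
        obtain ⟨a, ha⟩ := hψ v hv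
        exact Finset.mem_image.mpr ⟨a, mem_univ a, ha⟩
      have := (Finset.card_le_card hs).trans Finset.card_image_le
      simpa using this
    have h1 : (#{ψ : Fin m ↪ Fin n | ∀ v ∈ T, ∃ a, ψ a = v} : ℝ) ≤
        (m : ℝ) ^ T.card * (n : ℝ) ^ (m - T.card) := by
      exact_mod_cast card_filter_cover_le T
    rw [div_le_div_iff₀ (by positivity) (by positivity)]
    have h2 : (n : ℝ) ^ (m - 2) = (n : ℝ) ^ (m - T.card) * (n : ℝ) ^ r := by
      rw [← pow_add]; congr 1; omega
    have h3 : (m : ℝ) ^ T.card ≤ (m : ℝ) ^ 4 :=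
      pow_le_pow_right₀ (by exact_mod_cast (by omega : 1 ≤ m)) (by omega)
    rw [h2, ← mul_assoc]
    refine mul_le_mul_of_nonneg_right (h1.trans ?_) (by positivity)
    exact mul_le_mul_of_nonneg_right h3 (by positivity)

theorem exists_preimage_of_mem_copyEdges {G : SimpleGraph (Fin m)} {ψ : Fin m ↪ Fin n}
    {e : EdgeSet n} (h : e ∈ copyEdges G ψ) {v : Fin n} (hv : v ∈ e.1) : ∃ a, ψ a = v := by
  obtain ⟨y, -, hy⟩ := mem_copyEdges.mp h
  rw [← hy, Sym2.mem_map] at hv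
  obtain ⟨a, -, ha⟩ := hv
  exact ⟨a, ha⟩

theorem three_le_card_union {e e' : EdgeSet n} (h : e ≠ e') :
    3 ≤ (e.1.toFinset ∪ e'.1.toFinset).card := by
  by_contra! hc
  have h1 := Sym2.card_toFinset_of_not_isDiag _ e.2
  have h2 := Sym2.card_toFinset_of_not_isDiag _ e'.2
  have e1 := Finset.eq_of_subset_of_card_le
    (Finset.subset_union_left (s₁ := e.1.toFinset) (s₂ := e'.1.toFinset)) (by omega)
  have e2 := Finset.eq_of_subset_of_card_le
    (Finset.subset_union_right (s₁ := e.1.toFinset) (s₂ := e'.1.toFinset)) (by omega)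
  refine h (Subtype.ext (Sym2.ext fun v => ?_))
  rw [← Sym2.mem_toFinset, ← Sym2.mem_toFinset, e1, ← e2]

theorem card_union_eq_four {e e' : EdgeSet n} (h : ¬ ShareVertex e e') :
    (e.1.toFinset ∪ e'.1.toFinset).card = 4 := by
  have h1 := Sym2.card_toFinset_of_not_isDiag _ e.2
  have h2 := Sym2.card_toFinset_of_not_isDiag _ e'.2
  rw [Finset.card_union_of_disjoint, h1, h2]
  rw [Finset.disjoint_left]
  intro v hv hv'
  exact h ⟨v, Sym2.mem_toFinset.mp hv, Sym2.mem_toFinset.mp hv'⟩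

open scoped Classical in
theorem card_filter_pair_div_le (G : SimpleGraph (Fin m)) {e e' : EdgeSet n} {r : ℕ} (hr : r ≤ 2)
    (hcard : r + 2 ≤ (e.1.toFinset ∪ e'.1.toFinset).card) :
    (#{ψ : Fin m ↪ Fin n | e ∈ copyEdges G ψ ∧ e' ∈ copyEdges G ψ} : ℝ) / (n : ℝ) ^ (m - 2) ≤
      (m : ℝ) ^ 4 / (n : ℝ) ^ r := by
  have hn := two_le_of_edge e
  obtain ⟨T, hTs, hT⟩ := Finset.exists_subset_card_eq hcard
  refine le_trans (div_le_div_of_nonneg_right ?_ (by positivity))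
    (card_filter_cover_div_le (by omega) T hT hr)
  refine Nat.cast_le.mpr (Finset.card_le_card fun ψ hψ => ?_)
  simp only [Finset.mem_filter, Finset.mem_univ, true_and] at hψ ⊢
  intro v hv
  rcases Finset.mem_union.mp (hTs hv) with h | h
  · exact exists_preimage_of_mem_copyEdges hψ.1 (Sym2.mem_toFinset.mp h)
  · exact exists_preimage_of_mem_copyEdges hψ.2 (Sym2.mem_toFinset.mp h)

end Counting

section HamiltonianFacts

variable {n s : ℕ} (V : Fin s → ℕ) (G : ∀ i, SimpleGraph (Fin (V i))) (β : Fin s → ℝ)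

/-- The coefficient in the Hamiltonian of a placed copy of one of the graphs. -/
noncomputable def hamCoeff (k : Σ i, (Fin (V i) ↪ Fin n)) : ℝ :=
  β k.1 / (n : ℝ) ^ (V k.1 - 2)

/-- The edge set of a placed copy of one of the graphs. -/
noncomputable def hamSupp (k : Σ i, (Fin (V i) ↪ Fin n)) : Finset (EdgeSet n) :=
  copyEdges (G k.1) k.2

theorem Hamiltonian_eq_poly :
    Hamiltonian (n := n) V G β = poly (hamCoeff V β) (hamSupp V G) := by
  funext x
  rw [poly, Fintype.sum_sigma, Hamiltonian]
  refine Finset.sum_congr rfl fun i _ => ?_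
  rw [NG, Finset.mul_sum, Finset.sum_div]
  refine Finset.sum_congr rfl fun ψ _ => ?_
  rw [prod_edgeInd_eq_monomial, hamCoeff, hamSupp]
  ring

variable {β} in
theorem hamCoeff_nonneg (hβ : ∀ i, 0 < β i) (k : Σ i, (Fin (V i) ↪ Fin n)) :
    0 ≤ hamCoeff V β k :=
  div_nonneg (hβ _).le (by positivity)

theorem sum_ite_hamCoeff (P : (Σ i, (Fin (V i) ↪ Fin n)) → Prop) [DecidablePred P]
    (f : Fin s → ℝ) :
    ∑ k, (if P k then hamCoeff V β k * f k.1 else 0) =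
      ∑ i, β i * f i * ((#{ψ | P ⟨i, ψ⟩} : ℝ) / (n : ℝ) ^ (V i - 2)) := by
  rw [Fintype.sum_sigma]
  refine Finset.sum_congr rfl fun i _ => ?_
  rw [← Finset.sum_filter]
  simp only [hamCoeff, Finset.sum_const, nsmul_eq_mul]
  ring

theorem card_filter_mem_copyEdges_div_le {m : ℕ} (G : SimpleGraph (Fin m)) (e : EdgeSet n)
    [DecidablePred fun ψ : Fin m ↪ Fin n => e ∈ copyEdges G ψ] :
    (#{ψ : Fin m ↪ Fin n | e ∈ copyEdges G ψ} : ℝ) / (n : ℝ) ^ (m - 2) ≤ 2 * numEdges G := by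
  have hn : (0 : ℝ) < n := by exact_mod_cast (two_le_of_edge e).trans_lt' two_pos
  have h : #{ψ : Fin m ↪ Fin n | e ∈ copyEdges G ψ} =
      2 * numEdges G * (n - 2).descFactorial (m - 2) := by
    convert card_filter_mem_copyEdges_eq G e
  rw [h, div_le_iff₀ (by positivity)]
  push_cast
  exact mul_le_mul_of_nonneg_left descFactorial_le_mul_pow (by positivity)

theorem le_card_filter_mem_copyEdges_div {m : ℕ} (hm : m ≤ n) (G : SimpleGraph (Fin m))
    (e : EdgeSet n) [DecidablePred fun ψ : Fin m ↪ Fin n => e ∈ copyEdges G ψ] :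
    2 * numEdges G * (1 - (m : ℝ) ^ 2 / n) ≤
      (#{ψ : Fin m ↪ Fin n | e ∈ copyEdges G ψ} : ℝ) / (n : ℝ) ^ (m - 2) := by
  have hn : (0 : ℝ) < n := by exact_mod_cast (two_le_of_edge e).trans_lt' two_pos
  have h : #{ψ : Fin m ↪ Fin n | e ∈ copyEdges G ψ} =
      2 * numEdges G * (n - 2).descFactorial (m - 2) := by
    convert card_filter_mem_copyEdges_eq G e
  rw [h, le_div_iff₀ (by positivity)]
  push_cast
  rcases eq_or_ne (numEdges G) 0 with h0 | h0
  · simp [h0]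
  · rw [mul_assoc]
    exact mul_le_mul_of_nonneg_left
      (mul_pow_le_descFactorial (two_le_of_numEdges_pos h0) hm) (by positivity)

/-- The largest possible value of a discrete derivative of the Hamiltonian. -/
noncomputable def maxDeriv : ℝ := ∑ i, 2 * β i * (numEdges (G i) : ℝ)

/-- The constant controlling the second-order discrete derivatives of the Hamiltonian. -/
noncomputable def pairConst : ℝ := ∑ i, β i * (V i : ℝ) ^ 4

/-- The derivative of `Psi`. -/
noncomputable def dPsi (q : ℝ) : ℝ :=
  ∑ i, 2 * β i * (numEdges (G i) : ℝ) * (((numEdges (G i) - 1 : ℕ) : ℝ) * q ^ (numEdges (G i) - 2))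

theorem hasDerivAt_Psi (q : ℝ) : HasDerivAt (Psi V G β) (dPsi V G β q) q := by
  unfold Psi dPsi
  refine HasDerivAt.fun_sum fun i _ => ?_
  have := (hasDerivAt_pow (numEdges (G i) - 1) q).const_mul (2 * β i * (numEdges (G i) : ℝ))
  rwa [Nat.sub_sub] at this

variable {V G β} (hβ : ∀ i, 0 < β i)

include hβ in
theorem pairConst_nonneg : 0 ≤ pairConst V β :=
  Finset.sum_nonneg fun i _ => by have := (hβ i).le; positivity

include hβ in
theorem dPsi_nonneg {q : ℝ} (hq : 0 ≤ q) : 0 ≤ dPsi V G β q :=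
  Finset.sum_nonneg fun i _ => by have := (hβ i).le; positivity

include hβ in
theorem Psi_nonneg {q : ℝ} (hq : 0 ≤ q) : 0 ≤ Psi V G β q :=
  Finset.sum_nonneg fun i _ => by have := (hβ i).le; positivity

include hβ in
theorem Psi_le_maxDeriv {q : ℝ} (hq : 0 ≤ q) (hq1 : q ≤ 1) : Psi V G β q ≤ maxDeriv V G β :=
  Finset.sum_le_sum fun i _ => mul_le_of_le_one_right (by have := (hβ i).le; positivity)
    (pow_le_one₀ hq hq1)

include hβ in
theorem supermodular_Hamiltonian : Supermodular (Hamiltonian (n := n) V G β) := by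
  rw [Hamiltonian_eq_poly]
  exact supermodular_poly (hamCoeff_nonneg V hβ) _

include hβ in
theorem discDeriv_Hamiltonian_nonneg (e : EdgeSet n) (x : Config n) :
    0 ≤ discDeriv (Hamiltonian V G β) e x := by
  rw [Hamiltonian_eq_poly]
  exact discDeriv_poly_nonneg (hamCoeff_nonneg V hβ) _ _ _

include hβ in
theorem sum_ite_mem_hamSupp_le (e : EdgeSet n) {f : Fin s → ℝ} (hf : ∀ i, 0 ≤ f i) :
    ∑ k, (if e ∈ hamSupp V G k then hamCoeff V β k * f k.1 else 0) ≤
      ∑ i, 2 * β i * (numEdges (G i) : ℝ) * f i := by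
  rw [sum_ite_hamCoeff]
  refine Finset.sum_le_sum fun i _ => ?_
  have h := mul_le_mul_of_nonneg_left (card_filter_mem_copyEdges_div_le (G i) e)
    (mul_nonneg (hβ i).le (hf i))
  refine h.trans (le_of_eq (by ring))

include hβ in
theorem discDeriv_Hamiltonian_le (e : EdgeSet n) (x : Config n) :
    discDeriv (Hamiltonian V G β) e x ≤ maxDeriv V G β := by
  rw [Hamiltonian_eq_poly]
  refine (discDeriv_poly_le (hamCoeff_nonneg V hβ) _ _ _).trans ?_
  have := sum_ite_mem_hamSupp_le (G := G) hβ e (f := fun _ => 1) fun _ => zero_le_one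
  simpa [maxDeriv] using this

/-- The upper bound on the discrete second derivatives of the Hamiltonian. -/
noncomputable def hamPair (V : Fin s → ℕ) (G : ∀ i, SimpleGraph (Fin (V i))) (β : Fin s → ℝ)
    (e e' : EdgeSet n) : ℝ :=
  pairWeight (hamCoeff V β) (hamSupp V G) e e'

include hβ in
theorem hamPair_nonneg (e e' : EdgeSet n) : 0 ≤ hamPair V G β e e' :=
  Finset.sum_nonneg fun k _ => by
    have := hamCoeff_nonneg V hβ k
    split_ifs <;> simp [this]

include hβ in
theorem discDeriv_discDeriv_Hamiltonian_nonneg (e e' : EdgeSet n) (x : Config n) :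
    0 ≤ discDeriv (discDeriv (Hamiltonian V G β) e) e' x := by
  rw [Hamiltonian_eq_poly]
  exact discDeriv_discDeriv_poly_nonneg (hamCoeff_nonneg V hβ) _ _ _ _

include hβ in
theorem discDeriv_discDeriv_Hamiltonian_le (e e' : EdgeSet n) (x : Config n) :
    discDeriv (discDeriv (Hamiltonian V G β) e) e' x ≤ hamPair V G β e e' := by
  rw [Hamiltonian_eq_poly]
  exact discDeriv_discDeriv_poly_le (hamCoeff_nonneg V hβ) _ _ _ _

include hβ in
theorem hamPair_le_of_card {e e' : EdgeSet n} {r : ℕ} (hr : r ≤ 2)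
    (hcard : r + 2 ≤ (e.1.toFinset ∪ e'.1.toFinset).card) :
    hamPair V G β e e' ≤ pairConst V β / (n : ℝ) ^ r := by
  classical
  have h1 : hamPair V G β e e' ≤
      ∑ k, (if e ∈ hamSupp V G k ∧ e' ∈ hamSupp V G k then hamCoeff V β k * 1 else 0) := by
    refine Finset.sum_le_sum fun k _ => ?_
    have := hamCoeff_nonneg V hβ k
    split_ifs <;> simp_all
  refine h1.trans ?_
  rw [sum_ite_hamCoeff V β _ fun _ => 1, pairConst, Finset.sum_div]
  refine Finset.sum_le_sum fun i _ => ?_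
  rw [mul_one, mul_div_assoc]
  refine mul_le_mul_of_nonneg_left ?_ (hβ i).le
  have h := card_filter_pair_div_le (G i) hr hcard
  refine le_trans (le_of_eq ?_) h
  congr 2

include hβ in
theorem hamPair_le (e e' : EdgeSet n) : hamPair V G β e e' ≤ pairConst V β / n := by
  rcases eq_or_ne e e' with rfl | h
  · have := pairConst_nonneg (V := V) hβ
    simp only [hamPair, pairWeight, ne_eq, not_true_eq_false, and_false, if_false,
      Finset.sum_const_zero]
    positivity
  · simpa using hamPair_le_of_card hβ (r := 1) (by norm_num) (three_le_card_union h)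

include hβ in
theorem hamPair_le_of_not_shareVertex {e e' : EdgeSet n} (h : ¬ ShareVertex e e') :
    hamPair V G β e e' ≤ pairConst V β / (n : ℝ) ^ 2 :=
  hamPair_le_of_card hβ le_rfl (card_union_eq_four h).ge

include hβ in
theorem sum_bernWeight_discDeriv_Hamiltonian_le {q : ℝ} (hq : 0 ≤ q) (e : EdgeSet n) :
    ∑ x, bernWeight q x * discDeriv (Hamiltonian V G β) e x ≤ Psi V G β q := by
  rw [Hamiltonian_eq_poly, sum_bernWeight_discDeriv_poly]
  simp only [hamSupp, card_copyEdges]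
  exact sum_ite_mem_hamSupp_le (G := G) hβ e (f := fun i => q ^ (numEdges (G i) - 1))
    fun i => by positivity

include hβ in
theorem le_sum_bernWeight_discDeriv_Hamiltonian {q : ℝ} (hq : 0 ≤ q) (hq1 : q ≤ 1)
    (hn : ∀ i, V i ≤ n) (e : EdgeSet n) :
    Psi V G β q - (∑ i, 2 * β i * (numEdges (G i) : ℝ) * (V i : ℝ) ^ 2) / n ≤
      ∑ x, bernWeight q x * discDeriv (Hamiltonian V G β) e x := by
  rw [Hamiltonian_eq_poly, sum_bernWeight_discDeriv_poly]
  simp only [hamSupp, card_copyEdges]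
  rw [sum_ite_hamCoeff V β _ fun i => q ^ (numEdges (G i) - 1), Psi, Finset.sum_div,
    ← Finset.sum_sub_distrib]
  refine Finset.sum_le_sum fun i _ => ?_
  have h := mul_le_mul_of_nonneg_left (le_card_filter_mem_copyEdges_div (hn i) (G i) e)
    (mul_nonneg (hβ i).le (pow_nonneg hq (numEdges (G i) - 1)))
  refine le_trans ?_ h
  have h1 : q ^ (numEdges (G i) - 1) ≤ 1 := pow_le_one₀ hq hq1
  have h2 : 0 ≤ 2 * β i * (numEdges (G i) : ℝ) * ((V i : ℝ) ^ 2 / n) := by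
    have := (hβ i).le; positivity
  rw [mul_div_assoc]
  nlinarith [mul_le_mul_of_nonneg_left h1 h2]

include hβ in
theorem sum_bernWeight_interaction_Hamiltonian_le {q : ℝ} (hq : 0 ≤ q) (e : EdgeSet n) :
    ∑ x, bernWeight q x * interaction (Hamiltonian V G β) e x ≤ dPsi V G β q := by
  rw [Hamiltonian_eq_poly, sum_bernWeight_interaction_poly]
  simp only [hamSupp, card_copyEdges]
  exact sum_ite_mem_hamSupp_le (G := G) hβ e
    (f := fun i => ((numEdges (G i) - 1 : ℕ) : ℝ) * q ^ (numEdges (G i) - 2))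
    fun i => by positivity

include hβ in
theorem interaction_Hamiltonian_monotone (e : EdgeSet n) :
    Monotone (interaction (Hamiltonian V G β) e) := by
  rw [Hamiltonian_eq_poly]
  exact interaction_poly_monotone (hamCoeff_nonneg V hβ) _ _

include hβ in
theorem abs_discDeriv_interaction_Hamiltonian_le (e f : EdgeSet n) (x : Config n) :
    |discDeriv (interaction (Hamiltonian V G β) e) f x| ≤
      (∑ i, numEdges (G i) : ℕ) * hamPair V G β e f := by
  rw [Hamiltonian_eq_poly]
  refine abs_discDeriv_interaction_poly_le (hamCoeff_nonneg V hβ) _ (fun k => ?_) _ _ _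
  rw [hamSupp, card_copyEdges]
  exact Finset.single_le_sum (f := fun i => numEdges (G i)) (fun _ _ => Nat.zero_le _) (mem_univ _)

theorem ShareVertex.symm {e f : EdgeSet n} (h : ShareVertex e f) : ShareVertex f e := by
  obtain ⟨v, h1, h2⟩ := h
  exact ⟨v, h2, h1⟩

open scoped Classical in
theorem card_edge_mem_le (v : Fin n) : #{e : EdgeSet n | v ∈ e.1} ≤ n := by
  have h : #{e : EdgeSet n | v ∈ e.1} ≤ #((univ : Finset (Fin n)).image fun w => s(v, w)) := by
    refine Finset.card_le_card_of_injOn Subtype.val (fun e he => ?_)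
      Subtype.val_injective.injOn
    simp only [Finset.coe_filter, Finset.mem_univ, true_and, Set.mem_ofPred_eq] at he
    obtain ⟨w, hw⟩ := he
    simp only [Finset.coe_image, Set.mem_image, Finset.mem_coe, Finset.mem_univ, true_and]
    exact ⟨w, hw.symm⟩
  refine h.trans (Finset.card_image_le.trans ?_)
  simp

open scoped Classical in
theorem card_shareVertex_le (j : EdgeSet n) : #{e : EdgeSet n | ShareVertex e j} ≤ 2 * n := by
  have hsub : ({e : EdgeSet n | ShareVertex e j} : Finset (EdgeSet n)) ⊆
      j.1.toFinset.biUnion fun v => ({e : EdgeSet n | v ∈ e.1} : Finset (EdgeSet n)) := by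
    intro e he
    simp only [Finset.mem_filter, Finset.mem_univ, true_and, Finset.mem_biUnion] at he ⊢
    obtain ⟨v, h1, h2⟩ := he
    exact ⟨v, Sym2.mem_toFinset.mpr h2, h1⟩
  refine (Finset.card_le_card hsub).trans ((Finset.card_biUnion_le_card_mul _ _ n
    fun v _ => card_edge_mem_le v).trans ?_)
  rw [Sym2.card_toFinset_of_not_isDiag _ j.2]

open scoped Classical in
theorem card_shareVertex_both_le {j f : EdgeSet n} (hjf : ¬ ShareVertex j f) :
    #{e : EdgeSet n | ShareVertex e j ∧ ShareVertex e f} ≤ 4 := by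
  have h : #{e : EdgeSet n | ShareVertex e j ∧ ShareVertex e f} ≤
      #((j.1.toFinset ×ˢ f.1.toFinset).image fun vw => s(vw.1, vw.2)) := by
    refine Finset.card_le_card_of_injOn Subtype.val (fun e he => ?_)
      Subtype.val_injective.injOn
    simp only [Finset.coe_filter, Finset.mem_univ, true_and, Set.mem_ofPred_eq] at he
    obtain ⟨⟨v, hv, hvj⟩, w, hw, hwf⟩ := he
    have hvw : v ≠ w := fun h => hjf ⟨v, hvj, h ▸ hwf⟩
    simp only [Finset.coe_image, Set.mem_image, Finset.mem_coe, Finset.mem_product,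
      Sym2.mem_toFinset, Prod.exists]
    exact ⟨v, w, ⟨hvj, hwf⟩, ((Sym2.mem_and_mem_iff hvw).mp ⟨hv, hw⟩).symm⟩
  refine h.trans (Finset.card_image_le.trans ?_)
  rw [Finset.card_product, Sym2.card_toFinset_of_not_isDiag _ j.2,
    Sym2.card_toFinset_of_not_isDiag _ f.2]

theorem card_edgeSet_le : Fintype.card (EdgeSet n) ≤ n ^ 2 := by
  have := Sym2.card_subtype_not_diag (α := Fin n)
  rw [Fintype.card_fin] at this
  have h2 : Fintype.card (EdgeSet n) = n.choose 2 := by rw [← this]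
  rw [h2]
  exact Nat.choose_le_pow n 2

include hβ in
theorem sum_hamPair_sq_le (e : EdgeSet n) :
    ∑ f, hamPair V G β e f ^ 2 ≤ 3 * pairConst V β ^ 2 / n := by
  classical
  have hn : (1 : ℝ) ≤ n := by exact_mod_cast (two_le_of_edge e).trans' one_le_two
  have hP := pairConst_nonneg (V := V) hβ
  set P := pairConst V β
  have h1 : ∀ f, hamPair V G β e f ^ 2 ≤
      (if ShareVertex f e then (P / n) ^ 2 else 0) + (P / (n : ℝ) ^ 2) ^ 2 := by
    intro f
    split_ifs with h
    · have := pow_le_pow_left₀ (hamPair_nonneg (G := G) hβ e f) (hamPair_le hβ e f) 2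
      have h0 : 0 ≤ (P / (n : ℝ) ^ 2) ^ 2 := by positivity
      linarith
    · rw [zero_add]
      exact pow_le_pow_left₀ (hamPair_nonneg hβ e f)
        (hamPair_le_of_not_shareVertex hβ fun h' => h h'.symm) 2
  refine (Finset.sum_le_sum fun f _ => h1 f).trans ?_
  rw [Finset.sum_add_distrib, ← Finset.sum_filter, Finset.sum_const, Finset.sum_const,
    nsmul_eq_mul, nsmul_eq_mul, Finset.card_univ]
  have h2 : (#{f : EdgeSet n | ShareVertex f e} : ℝ) ≤ 2 * n := by
    exact_mod_cast card_shareVertex_le e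
  have h3 : (Fintype.card (EdgeSet n) : ℝ) ≤ (n : ℝ) ^ 2 := by exact_mod_cast card_edgeSet_le
  have h4 := mul_le_mul_of_nonneg_right h2 (by positivity : 0 ≤ (P / n) ^ 2)
  have h5 := mul_le_mul_of_nonneg_right h3 (by positivity : 0 ≤ (P / (n : ℝ) ^ 2) ^ 2)
  have h6 : 2 * (n : ℝ) * (P / n) ^ 2 = 2 * P ^ 2 / n := by field_simp
  have h7 : (n : ℝ) ^ 2 * (P / (n : ℝ) ^ 2) ^ 2 = P ^ 2 / (n : ℝ) ^ 2 := by field_simp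
  have h8 : P ^ 2 / (n : ℝ) ^ 2 ≤ P ^ 2 / n :=
    div_le_div_of_nonneg_left (by positivity) (by positivity) (by nlinarith)
  have h9 : 3 * P ^ 2 / (n : ℝ) = 2 * P ^ 2 / n + P ^ 2 / n := by ring
  linarith

end HamiltonianFacts

section Concentration

theorem forall_gt_of_step {g : ℝ → ℝ} (hg : Continuous g) {t₀ B : ℝ}
    (huniq : ∀ t, g t = t → t = t₀) (hB : ∀ t, g t ≤ B) {P : ℝ → Prop}
    (hup : ∀ s t, s ≤ t → P s → P t) (hP : ∃ b, P b)
    (hstep : ∀ t, P t → ∀ η, 0 < η → P (g t + η)) : ∀ t, t₀ < t → P t := by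
  intro a ha
  by_contra hPa
  have hbdd : ∀ s ∈ {s | P s}, a ≤ s := fun s hs => by
    by_contra! h
    exact hPa (hup s a h.le hs)
  set m := sInf {s | P s} with hm
  have ham : a ≤ m := le_csInf hP hbdd
  have hgm : g m < m := by
    by_contra! h
    have hmB : m ≤ max m B + 1 := by linarith [le_max_left m B]
    have hend : g (max m B + 1) ≤ max m B + 1 := by linarith [hB (max m B + 1), le_max_right m B]
    obtain ⟨z, hz, hgz⟩ := intermediate_value_Icc' hmB (hg.sub continuous_id).continuousOn
      (show (0 : ℝ) ∈ Set.Icc _ _ from ⟨by simpa using hend, by simpa using h⟩)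
    have := huniq z (sub_eq_zero.mp hgz)
    linarith [hz.1]
  obtain ⟨ε, hε, hnear⟩ := Metric.continuousAt_iff.mp (hg.continuousAt (x := m)) (m - g m) (by linarith)
  obtain ⟨s, hs, hsm⟩ := exists_lt_of_csInf_lt hP (show m < m + ε by linarith)
  have hms : m ≤ s := csInf_le ⟨a, hbdd⟩ hs
  have hgs : g s < m := by
    have h := hnear (x := s) (by rw [Real.dist_eq, abs_of_nonneg] <;> linarith)
    rw [Real.dist_eq] at h
    linarith [(abs_lt.mp h).2]
  have h := csInf_le ⟨a, hbdd⟩ (hstep s hs ((m - g s) / 2) (by linarith))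
  linarith

theorem exp_neg_mul_le_div_pow {c u : ℝ} (hc : 0 < c) (hu : 0 < u) :
    Real.exp (-(c * u)) ≤ 24 / c ^ 4 / u ^ 4 := by
  have h := Real.pow_div_factorial_le_exp (c * u) (by positivity) 4
  rw [Real.exp_neg, div_div, ← mul_pow, inv_le_comm₀ (Real.exp_pos _) (by positivity), inv_div]
  simpa [Nat.factorial] using h

variable {s : ℕ} {V : Fin s → ℕ} {G : ∀ i, SimpleGraph (Fin (V i))} {β : Fin s → ℝ}

theorem bernWeight_tail_of_hamPair (hβ : ∀ i, 0 < β i) (L : ℝ) {η : ℝ} (hη : 0 < η) :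
    ∃ C : ℝ, 0 ≤ C ∧ ∀ (n : ℕ) (e : EdgeSet n) (f : Config n → ℝ),
      (∀ e' x, |discDeriv f e' x| ≤ L * hamPair V G β e e') →
      ∀ q, 0 < q → q < 1 → ∀ y, ∑ x, bernWeight q x * f x + η ≤ y →
        mass (bernWeight q) (fun x => y ≤ f x) ≤ C / (n : ℝ) ^ 4 := by
  set A : ℝ := L ^ 2 * (3 * pairConst V β ^ 2) + 1 with hA
  have hA0 : 0 < A := by positivity
  set c : ℝ := η ^ 2 / (4 * A) with hc
  have hc0 : 0 < c := by positivity
  refine ⟨24 / c ^ 4, by positivity, fun n e f hf q h0 h1 y hy => ?_⟩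
  have hn : (0 : ℝ) < n := by exact_mod_cast (two_le_of_edge e).trans_lt' two_pos
  have hsum : ∑ e', (L * hamPair V G β e e') ^ 2 ≤ A / n := by
    simp only [mul_pow]
    rw [← Finset.mul_sum]
    refine (mul_le_mul_of_nonneg_left (sum_hamPair_sq_le hβ e) (sq_nonneg L)).trans ?_
    rw [← mul_div_assoc]
    exact div_le_div_of_nonneg_right (by linarith) hn.le
  refine (bernWeight_tail h0 h1 _ f hf (by positivity : 0 < A / n) hη.le hsum hy).trans ?_
  refine le_trans (le_of_eq ?_) (exp_neg_mul_le_div_pow hc0 hn)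
  congr 2
  rw [hc]
  field_simp

/-- A sequence of events with probability of order at most `n⁻²` under the model. -/
def Negligible (V : Fin s → ℕ) (G : ∀ i, SimpleGraph (Fin (V i))) (β : Fin s → ℝ)
    (A : ∀ n, Config n → Prop) : Prop :=
  ∃ C : ℝ, ∃ N : ℕ, ∀ n, N ≤ n → mass (gibbs (Hamiltonian V G β)) (A n) ≤ C / (n : ℝ) ^ 2

theorem Negligible.mono {A B : ∀ n, Config n → Prop} (hA : Negligible V G β A)
    (h : ∀ n x, B n x → A n x) : Negligible V G β B := by
  obtain ⟨C, N, hN⟩ := hA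
  exact ⟨C, N, fun n hn => (mass_mono (fun x => (gibbs_pos _ x).le) (h n)).trans (hN n hn)⟩

theorem Negligible.or {A B : ∀ n, Config n → Prop} (hA : Negligible V G β A)
    (hB : Negligible V G β B) : Negligible V G β (fun n x => A n x ∨ B n x) := by
  obtain ⟨C, N, hN⟩ := hA
  obtain ⟨C', N', hN'⟩ := hB
  refine ⟨C + C', max N N', fun n hn => ?_⟩
  rw [add_div]
  exact (mass_or_le (fun x => (gibbs_pos _ x).le) _ _).trans
    (add_le_add (hN n ((le_max_left _ _).trans hn)) (hN' n ((le_max_right _ _).trans hn)))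

theorem negligible_false {A : ∀ n, Config n → Prop} (h : ∀ n x, ¬ A n x) :
    Negligible V G β A := by
  refine ⟨0, 0, fun n _ => le_of_eq ?_⟩
  rw [zero_div]
  exact Finset.sum_eq_zero fun x _ => if_neg (h n x)

theorem negligible_of_le {A A' : ∀ n, Config n → Prop} (hA : Negligible V G β A) {C : ℝ}
    (hC : 0 ≤ C) {N : ℕ} {u : ∀ n, EdgeSet n → ℝ}
    (hu : ∀ n, N ≤ n → ∀ e, u n e ≤ C / (n : ℝ) ^ 4)
    (h : ∀ n, mass (gibbs (Hamiltonian V G β)) (A' n) ≤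
      mass (gibbs (Hamiltonian V G β)) (A n) + ∑ e, u n e) : Negligible V G β A' := by
  obtain ⟨C₁, N₁, hN₁⟩ := hA
  refine ⟨C₁ + C, max (max N₁ N) 1, fun n hn => (h n).trans ?_⟩
  have hn1 : N₁ ≤ n := by omega
  have hn2 : N ≤ n := by omega
  have hn0 : (0 : ℝ) < n := by exact_mod_cast (by omega : 0 < n)
  rw [add_div]
  refine add_le_add (hN₁ n hn1) ((Finset.sum_le_sum fun e _ => hu n hn2 e).trans ?_)
  rw [Finset.sum_const, Finset.card_univ, nsmul_eq_mul]
  have h3 : (Fintype.card (EdgeSet n) : ℝ) ≤ (n : ℝ) ^ 2 := by exact_mod_cast card_edgeSet_le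
  refine (mul_le_mul_of_nonneg_right h3 (by positivity)).trans (le_of_eq ?_)
  field_simp

theorem negligible_exists_le (hβ : ∀ i, 0 < β i) {t : ℝ}
    (ht : Negligible V G β fun _ x => ∃ e, t ≤ discDeriv (Hamiltonian V G β) e x)
    {Y : ∀ n, EdgeSet n → Config n → ℝ} (hY : ∀ n e, Monotone (Y n e)) {L : ℝ}
    (hL : ∀ n e e' x, |discDeriv (Y n e) e' x| ≤ L * hamPair V G β e e') {μ : ℝ}
    (hμ : ∀ n e, ∑ x, bernWeight (Phi t) x * Y n e x ≤ μ) {η : ℝ} (hη : 0 < η) :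
    Negligible V G β fun n x => ∃ e, μ + η ≤ Y n e x := by
  obtain ⟨C, hC, htail⟩ := bernWeight_tail_of_hamPair (G := G) hβ L hη
  exact negligible_of_le ht hC (N := 0)
    (fun n _ e => htail n e (Y n e) (hL n e) (Phi t) (Phi_pos t) (Phi_lt_one t) (μ + η)
      (by linarith [hμ n e]))
    fun n => gibbs_mass_exists_le (supermodular_Hamiltonian hβ) t (μ + η) (Y n) (hY n)

theorem negligible_exists_ge (hβ : ∀ i, 0 < β i) {t : ℝ}
    (ht : Negligible V G β fun _ x => ∃ e, discDeriv (Hamiltonian V G β) e x ≤ t)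
    {Y : ∀ n, EdgeSet n → Config n → ℝ} (hY : ∀ n e, Monotone (Y n e)) {L : ℝ}
    (hL : ∀ n e e' x, |discDeriv (Y n e) e' x| ≤ L * hamPair V G β e e') {μ : ℝ} {N : ℕ} {η : ℝ}
    (hη : 0 < η) (hμ : ∀ n, N ≤ n → ∀ e, μ - η ≤ ∑ x, bernWeight (Phi t) x * Y n e x) :
    Negligible V G β fun n x => ∃ e, Y n e x ≤ μ - 2 * η := by
  obtain ⟨C, hC, htail⟩ := bernWeight_tail_of_hamPair (G := G) hβ L hη
  refine negligible_of_le ht hC (N := N) (fun n hn e => ?_)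
    fun n => gibbs_mass_exists_ge (supermodular_Hamiltonian hβ) t (μ - 2 * η) (Y n) (hY n)
  have h := htail n e (fun x => -Y n e x) (fun e' x => ?_) (Phi t) (Phi_pos t) (Phi_lt_one t)
    (-(μ - 2 * η)) ?_
  · simpa only [neg_le_neg_iff] using h
  · refine le_trans (le_of_eq ?_) (hL n e e' x)
    rw [← abs_neg]
    simp only [discDeriv]
    congr 1
    ring
  · simp only [mul_neg, Finset.sum_neg_distrib]
    linarith [hμ n hn e]

theorem abs_discDeriv_discDeriv_Hamiltonian_le (hβ : ∀ i, 0 < β i) {n : ℕ} (e e' : EdgeSet n)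
    (x : Config n) :
    |discDeriv (discDeriv (Hamiltonian V G β) e) e' x| ≤ 1 * hamPair V G β e e' := by
  rw [one_mul, abs_of_nonneg (discDeriv_discDeriv_Hamiltonian_nonneg hβ e e' x)]
  exact discDeriv_discDeriv_Hamiltonian_le hβ e e' x

theorem continuous_Psi : Continuous (Psi V G β) :=
  continuous_iff_continuousAt.mpr fun q => (hasDerivAt_Psi V G β q).continuousAt

theorem continuous_dPsi : Continuous (dPsi V G β) := by
  unfold dPsi
  fun_prop

theorem eq_of_Psi_Phi_eq {p : ℝ} (hsub : Subcritical V G β p) {t : ℝ} (ht : Psi V G β (Phi t) = t) :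
    t = Psi V G β p := by
  have h : Phi t = p := hsub.2.1 _ (by rw [phiFn, ht])
  rw [← h, ht]

theorem negligible_exists_discDeriv_ge (hβ : ∀ i, 0 < β i) {p : ℝ} (hsub : Subcritical V G β p)
    {t : ℝ} (ht : Psi V G β p < t) :
    Negligible V G β fun _ x => ∃ e, t ≤ discDeriv (Hamiltonian V G β) e x := by
  refine forall_gt_of_step (g := fun t => Psi V G β (Phi t)) (B := maxDeriv V G β)
    (continuous_Psi.comp continuous_Phi) (fun t h => eq_of_Psi_Phi_eq hsub h)
    (fun t => Psi_le_maxDeriv hβ (Phi_pos t).le (Phi_lt_one t).le)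
    (P := fun t => Negligible V G β fun _ x => ∃ e, t ≤ discDeriv (Hamiltonian V G β) e x)
    (fun s t hst h => h.mono fun n x ⟨e, he⟩ => ⟨e, hst.trans he⟩)
    ⟨maxDeriv V G β + 1, negligible_false fun n x ⟨e, he⟩ => ?_⟩ (fun t h η hη => ?_) t ht
  · linarith [discDeriv_Hamiltonian_le (G := G) hβ e x]
  · exact negligible_exists_le hβ h
      (fun n e => (supermodular_Hamiltonian hβ).monotone_discDeriv e)
      (fun n e e' x => abs_discDeriv_discDeriv_Hamiltonian_le hβ e e' x)
      (fun n e => sum_bernWeight_discDeriv_Hamiltonian_le hβ (Phi_pos t).le e) hη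

theorem negligible_exists_discDeriv_le (hβ : ∀ i, 0 < β i) {p : ℝ} (hsub : Subcritical V G β p)
    {t : ℝ} (ht : t < Psi V G β p) :
    Negligible V G β fun _ x => ∃ e, discDeriv (Hamiltonian V G β) e x ≤ t := by
  have key := forall_gt_of_step (g := fun t => -Psi V G β (Phi (-t))) (B := 0)
    (t₀ := -Psi V G β p) (continuous_Psi.comp (continuous_Phi.comp continuous_neg)).neg
    (fun t h => ?_) (fun t => by linarith [Psi_nonneg (G := G) hβ (Phi_pos (-t)).le])
    (P := fun t => Negligible V G β fun _ x => ∃ e, discDeriv (Hamiltonian V G β) e x ≤ -t)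
    (fun s t hst h => h.mono fun n x ⟨e, he⟩ => ⟨e, he.trans (neg_le_neg hst)⟩ ) ?_ ?_ (-t)
    (by linarith)
  · rwa [neg_neg] at key
  · have := eq_of_Psi_Phi_eq hsub (t := -t) (by linarith)
    linarith
  · refine ⟨1, negligible_false fun n x ⟨e, he⟩ => ?_⟩
    linarith [discDeriv_Hamiltonian_nonneg (G := G) hβ e x]
  · intro t h η hη
    obtain ⟨N, hN⟩ : ∃ N : ℕ, ∀ n : ℕ, N ≤ n →
        (∑ i, 2 * β i * (numEdges (G i) : ℝ) * (V i : ℝ) ^ 2) / n ≤ η / 2 := by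
      have := tendsto_const_div_atTop_nhds_zero_nat
        (∑ i, 2 * β i * (numEdges (G i) : ℝ) * (V i : ℝ) ^ 2)
      exact eventually_atTop.mp (this.eventually_le_const (by linarith))
    refine (negligible_exists_ge hβ h
      (fun n e => (supermodular_Hamiltonian hβ).monotone_discDeriv e)
      (fun n e e' x => abs_discDeriv_discDeriv_Hamiltonian_le hβ e e' x)
      (μ := Psi V G β (Phi (-t))) (N := max N (∑ i, V i)) (half_pos hη) fun n hn e => ?_).mono
      fun n x ⟨e, he⟩ => ⟨e, by linarith⟩
    have h1 := le_sum_bernWeight_discDeriv_Hamiltonian (G := G) hβ (Phi_pos (-t)).le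
      (Phi_lt_one (-t)).le (fun i => (Finset.single_le_sum (f := V) (fun _ _ => Nat.zero_le _)
        (mem_univ i)).trans ((le_max_right _ _).trans hn)) e
    linarith [hN n ((le_max_left _ _).trans hn)]

theorem negligible_exists_interaction_ge (hβ : ∀ i, 0 < β i) {p : ℝ}
    (hsub : Subcritical V G β p) {κ : ℝ} (hκ : dPsi V G β p < κ) :
    Negligible V G β fun _ x => ∃ e, κ ≤ interaction (Hamiltonian V G β) e x := by
  have hΦ : Phi (Psi V G β p) = p := hsub.1
  have hcont : ContinuousAt (fun t => dPsi V G β (Phi t)) (Psi V G β p) :=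
    (continuous_dPsi.comp continuous_Phi).continuousAt
  have hev : ∀ᶠ t in nhds (Psi V G β p), dPsi V G β (Phi t) < κ :=
    hcont.eventually_lt_const (by simpa only [hΦ] using hκ)
  obtain ⟨t, ht, hκt⟩ := ((hev.filter_mono nhdsWithin_le_nhds).and
    (self_mem_nhdsWithin (s := Set.Ioi (Psi V G β p)))).exists
  refine (negligible_exists_le hβ (negligible_exists_discDeriv_ge hβ hsub hκt)
    (fun n e => interaction_Hamiltonian_monotone hβ e)
    (fun n e e' x => abs_discDeriv_interaction_Hamiltonian_le hβ e e' x)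
    (fun n e => sum_bernWeight_interaction_Hamiltonian_le hβ (Phi_pos t).le e)
    (sub_pos.mpr ht)).mono fun n x ⟨e, he⟩ => ⟨e, le_trans (le_of_eq (by ring)) he⟩

end Concentration

section Contraction

variable {n : ℕ}

open scoped Classical in
/-- Weights on the edges that decay with the number of vertices not shared with `j`. -/
noncomputable def edgeWeight (M₁ M₂ : ℝ) (j e : EdgeSet n) : ℝ :=
  (if e = j then 1 else 0) + (if ShareVertex e j then M₁ / n else 0) + M₂ / (n : ℝ) ^ 2

variable {M₁ M₂ : ℝ}

theorem edgeWeight_nonneg (h₁ : 0 ≤ M₁) (h₂ : 0 ≤ M₂) (j e : EdgeSet n) :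
    0 ≤ edgeWeight M₁ M₂ j e := by
  unfold edgeWeight
  split_ifs <;> positivity

theorem one_le_edgeWeight_self (h₁ : 0 ≤ M₁) (h₂ : 0 ≤ M₂) (j : EdgeSet n) :
    1 ≤ edgeWeight M₁ M₂ j j := by
  have h3 : 0 ≤ M₁ / n := by positivity
  have h4 : 0 ≤ M₂ / (n : ℝ) ^ 2 := by positivity
  unfold edgeWeight
  rw [if_pos rfl]
  split_ifs <;> linarith

theorem edgeWeight_of_not_shareVertex {j e : EdgeSet n} (he : e ≠ j) (h : ¬ ShareVertex e j) :
    edgeWeight M₁ M₂ j e = M₂ / (n : ℝ) ^ 2 := by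
  rw [edgeWeight, if_neg he, if_neg h, zero_add, zero_add]

theorem one_le_cast_of_edge (e : EdgeSet n) : (1 : ℝ) ≤ n := by
  exact_mod_cast (two_le_of_edge e).trans' one_le_two

theorem edgeWeight_le_of_ne (h₁ : 0 ≤ M₁) (h₂ : 0 ≤ M₂) {j e : EdgeSet n} (he : e ≠ j) :
    edgeWeight M₁ M₂ j e ≤ (M₁ + M₂) / n := by
  have hn := one_le_cast_of_edge j
  have h3 : 0 ≤ M₁ / n := by positivity
  have h4 : M₂ / (n : ℝ) ^ 2 ≤ M₂ / n :=
    div_le_div_of_nonneg_left h₂ (by positivity) (by nlinarith)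
  rw [edgeWeight, if_neg he, add_div]
  split_ifs <;> linarith

theorem sum_edgeWeight_le (h₁ : 0 ≤ M₁) (h₂ : 0 ≤ M₂) (j : EdgeSet n) :
    ∑ e, edgeWeight M₁ M₂ j e ≤ 1 + 2 * M₁ + M₂ := by
  classical
  have hn := one_le_cast_of_edge j
  have hshare : (#{e : EdgeSet n | ShareVertex e j} : ℝ) ≤ 2 * n := by
    exact_mod_cast card_shareVertex_le j
  have hcard : (Fintype.card (EdgeSet n) : ℝ) ≤ (n : ℝ) ^ 2 := by exact_mod_cast card_edgeSet_le
  simp only [edgeWeight, Finset.sum_add_distrib, Finset.sum_ite_eq', Finset.mem_univ, if_true,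
    ← Finset.sum_filter, Finset.sum_const, nsmul_eq_mul, Finset.card_univ]
  have h3 := mul_le_mul_of_nonneg_right hshare (by positivity : 0 ≤ M₁ / n)
  have h4 := mul_le_mul_of_nonneg_right hcard (by positivity : 0 ≤ M₂ / (n : ℝ) ^ 2)
  have h5 : 2 * (n : ℝ) * (M₁ / n) = 2 * M₁ := by field_simp
  have h6 : (n : ℝ) ^ 2 * (M₂ / (n : ℝ) ^ 2) = M₂ := by field_simp
  refine add_le_add (add_le_add le_rfl ?_) ?_
  · refine le_trans (le_of_eq ?_) (h3.trans h5.le)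
    congr
  · exact h4.trans h6.le

theorem sum_shareVertex_le {d : EdgeSet n → ℝ} {f j : EdgeSet n} {P : ℝ} (hP : 0 ≤ P)
    (hd : ∀ e, d e ≤ P / n) (hd' : ∀ e, ¬ ShareVertex e f → d e ≤ P / (n : ℝ) ^ 2)
    (hjf : ¬ ShareVertex j f) [DecidablePred fun e => ShareVertex e j] :
    ∑ e with ShareVertex e j, d e ≤ 6 * P / n := by
  classical
  have hn := one_le_cast_of_edge j
  have h1 : ∀ e, d e ≤ (if ShareVertex e f then P / n else 0) + P / (n : ℝ) ^ 2 := by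
    intro e
    have h0 : 0 ≤ P / (n : ℝ) ^ 2 := by positivity
    split_ifs with h
    · linarith [hd e]
    · linarith [hd' e h]
  refine (Finset.sum_le_sum fun e _ => h1 e).trans ?_
  rw [Finset.sum_add_distrib, ← Finset.sum_filter, Finset.filter_filter, Finset.sum_const,
    Finset.sum_const, nsmul_eq_mul, nsmul_eq_mul]
  have h2 : (#{e : EdgeSet n | ShareVertex e j ∧ ShareVertex e f} : ℝ) ≤ 4 := by
    have := card_shareVertex_both_le hjf
    have h : #{e : EdgeSet n | ShareVertex e j ∧ ShareVertex e f} ≤ 4 := by convert this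
    exact_mod_cast h
  have h3 : (#{e : EdgeSet n | ShareVertex e j} : ℝ) ≤ 2 * n := by
    have h : #{e : EdgeSet n | ShareVertex e j} ≤ 2 * n := by
      convert card_shareVertex_le j
    exact_mod_cast h
  have h4 := mul_le_mul_of_nonneg_right h2 (by positivity : 0 ≤ P / n)
  have h5 := mul_le_mul_of_nonneg_right h3 (by positivity : 0 ≤ P / (n : ℝ) ^ 2)
  have h6 : 2 * (n : ℝ) * (P / (n : ℝ) ^ 2) = 2 * P / n := by field_simp
  have h7 : 6 * P / (n : ℝ) = 4 * (P / n) + 2 * P / n := by ring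
  linarith

theorem sum_edgeWeight_mul_le {d : EdgeSet n → ℝ} {f j : EdgeSet n} {P κ α ρ : ℝ} (hP : 0 ≤ P)
    (hα : 0 ≤ α) (hd0 : ∀ e, 0 ≤ d e) (hd : ∀ e, d e ≤ P / n)
    (hd' : ∀ e, ¬ ShareVertex e f → d e ≤ P / (n : ℝ) ^ 2) (hκ : ∑ e, d e ≤ κ)
    (h₁ : 0 ≤ M₁) (h₂ : 0 ≤ M₂) (hρ0 : 0 ≤ ρ) (hM₁ : α * P + α * κ * M₁ ≤ ρ * M₁)
    (hM₂ : α * P * (1 + 6 * M₁) + α * κ * M₂ ≤ ρ * M₂) :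
    ∑ e, edgeWeight M₁ M₂ j e * (α * d e) ≤ ρ * edgeWeight M₁ M₂ j f := by
  classical
  have hn := one_le_cast_of_edge j
  have hexp : ∑ e, edgeWeight M₁ M₂ j e * (α * d e) =
      α * (d j + M₁ / n * (∑ e with ShareVertex e j, d e) + M₂ / (n : ℝ) ^ 2 * ∑ e, d e) := by
    have : ∀ e, edgeWeight M₁ M₂ j e * (α * d e) =
        α * ((if e = j then d e else 0) + M₁ / n * (if ShareVertex e j then d e else 0) +
          M₂ / (n : ℝ) ^ 2 * d e) := by
      intro e
      simp only [edgeWeight]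
      split_ifs <;> ring
    rw [Finset.sum_congr rfl fun e _ => this e, ← Finset.mul_sum, Finset.sum_add_distrib,
      Finset.sum_add_distrib, ← Finset.mul_sum, ← Finset.mul_sum, Finset.sum_ite_eq',
      if_pos (Finset.mem_univ j), Finset.sum_filter]
  rw [hexp]
  have hM₂n : 0 ≤ M₂ / (n : ℝ) ^ 2 := by positivity
  have hM₁n : 0 ≤ M₁ / n := by positivity
  have e3 := mul_le_mul_of_nonneg_left hκ hM₂n
  have hw0 : (0 : ℝ) ≤ if f = j then 1 else 0 := by split_ifs <;> norm_num
  by_cases hs : ShareVertex j f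
  · have e1 : ∑ e with ShareVertex e j, d e ≤ κ :=
      (Finset.sum_le_sum_of_subset_of_nonneg (Finset.filter_subset _ _)
        fun e _ _ => hd0 e).trans hκ
    have e2 := mul_le_mul_of_nonneg_left e1 hM₁n
    have e4 : α * (d j + M₁ / n * (∑ e with ShareVertex e j, d e) +
        M₂ / (n : ℝ) ^ 2 * ∑ e, d e) ≤ α * (P / n + M₁ / n * κ + M₂ / (n : ℝ) ^ 2 * κ) :=
      mul_le_mul_of_nonneg_left (by linarith [hd j]) hα
    refine e4.trans ?_
    have e5 := div_le_div_of_nonneg_right hM₁ (by positivity : (0 : ℝ) ≤ n)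
    have hαP : 0 ≤ α * P * (1 + 6 * M₁) := by positivity
    have e6 := div_le_div_of_nonneg_right (by linarith : α * κ * M₂ ≤ ρ * M₂)
      (by positivity : (0 : ℝ) ≤ (n : ℝ) ^ 2)
    have e7 := mul_nonneg hρ0 hw0
    simp only [edgeWeight, if_pos hs.symm]
    have e8 : α * (P / n + M₁ / n * κ + M₂ / (n : ℝ) ^ 2 * κ) =
      (α * P + α * κ * M₁) / n + α * κ * M₂ / (n : ℝ) ^ 2 := by ring
    have e9 : ρ * ((if f = j then 1 else 0) + M₁ / n + M₂ / (n : ℝ) ^ 2) =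
      ρ * (if f = j then 1 else 0) + ρ * M₁ / n + ρ * M₂ / (n : ℝ) ^ 2 := by ring
    rw [e8, e9]
    linarith
  · have e1 := sum_shareVertex_le hP hd hd' hs
    have e2 := mul_le_mul_of_nonneg_left e1 hM₁n
    have e4 : α * (d j + M₁ / n * (∑ e with ShareVertex e j, d e) +
        M₂ / (n : ℝ) ^ 2 * ∑ e, d e) ≤
        α * (P / (n : ℝ) ^ 2 + M₁ / n * (6 * P / n) + M₂ / (n : ℝ) ^ 2 * κ) :=
      mul_le_mul_of_nonneg_left (by linarith [hd' j hs]) hα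
    refine e4.trans ?_
    have e6 := div_le_div_of_nonneg_right hM₂ (by positivity : (0 : ℝ) ≤ (n : ℝ) ^ 2)
    have e7 := mul_nonneg hρ0 hw0
    simp only [edgeWeight, if_neg fun h : ShareVertex f j => hs h.symm]
    have e8 : α * (P / (n : ℝ) ^ 2 + M₁ / n * (6 * P / n) + M₂ / (n : ℝ) ^ 2 * κ) =
      (α * P * (1 + 6 * M₁) + α * κ * M₂) / (n : ℝ) ^ 2 := by ring
    have e9 : ρ * ((if f = j then 1 else 0) + 0 + M₂ / (n : ℝ) ^ 2) =
      ρ * (if f = j then 1 else 0) + ρ * M₂ / (n : ℝ) ^ 2 := by ring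
    rw [e8, e9]
    linarith

variable {s : ℕ} {V : Fin s → ℕ} {G : ∀ i, SimpleGraph (Fin (V i))} {β : Fin s → ℝ}

/-- The configurations at which all discrete derivatives of the Hamiltonian are within `ε` of `t`
and all total interactions are below `κ`. -/
def typicalSet (n : ℕ) (V : Fin s → ℕ) (G : ∀ i, SimpleGraph (Fin (V i))) (β : Fin s → ℝ)
    (t ε κ : ℝ) : Set (Config n) :=
  {x | ∀ e, t - ε < discDeriv (Hamiltonian V G β) e x ∧
    discDeriv (Hamiltonian V G β) e x < t + ε ∧ interaction (Hamiltonian V G β) e x < κ}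

theorem ordConnected_typicalSet (hβ : ∀ i, 0 < β i) (t ε κ : ℝ) :
    (typicalSet n V G β t ε κ).OrdConnected := by
  refine ⟨fun x hx y hy z hz e => ?_⟩
  have hT := (supermodular_Hamiltonian (n := n) (G := G) hβ).monotone_discDeriv e
  have hK := interaction_Hamiltonian_monotone (n := n) (G := G) hβ e
  exact ⟨(hx e).1.trans_le (hT hz.1), (hT hz.2).trans_lt (hy e).2.1,
    (hK hz.2).trans_lt (hy e).2.2⟩

theorem negligible_notMem_typicalSet (hβ : ∀ i, 0 < β i) {p : ℝ} (hsub : Subcritical V G β p)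
    {ε κ : ℝ} (hε : 0 < ε) (hκ : dPsi V G β p < κ) :
    Negligible V G β fun n x => x ∉ typicalSet n V G β (Psi V G β p) ε κ := by
  refine ((negligible_exists_discDeriv_le hβ hsub
    (show Psi V G β p - ε < Psi V G β p by linarith)).or
    ((negligible_exists_discDeriv_ge hβ hsub
    (show Psi V G β p < Psi V G β p + ε by linarith)).or
    (negligible_exists_interaction_ge hβ hsub hκ))).mono fun n x hx => ?_
  by_contra! h
  exact hx fun e => ⟨h.1 e, h.2.1 e, h.2.2 e⟩

theorem sum_edgeWeight_mul_discDeriv_Phi_le (hβ : ∀ i, 0 < β i) {t ε κ α ρ : ℝ} (hα : 0 ≤ α)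
    (hΦ : ∀ r ∈ Set.Icc (t - ε) (t + ε), Phi r * (1 - Phi r) ≤ α)
    (h₁ : 0 ≤ M₁) (h₂ : 0 ≤ M₂) (hρ0 : 0 ≤ ρ)
    (hM₁ : α * pairConst V β + α * κ * M₁ ≤ ρ * M₁)
    (hM₂ : α * pairConst V β * (1 + 6 * M₁) + α * κ * M₂ ≤ ρ * M₂)
    (j : EdgeSet n) (x : Config n) (f : EdgeSet n)
    (hx0 : Function.update x f false ∈ typicalSet n V G β t ε κ)
    (hx1 : Function.update x f true ∈ typicalSet n V G β t ε κ) :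
    ∑ e, edgeWeight M₁ M₂ j e *
      discDeriv (fun x => Phi (discDeriv (Hamiltonian V G β) e x)) f x ≤
        ρ * edgeWeight M₁ M₂ j f := by
  have hx : x ∈ typicalSet n V G β t ε κ := by
    rw [← Function.update_eq_self f x]
    rcases x f with _ | _
    · exact hx0
    · exact hx1
  have hlip : ∀ e, discDeriv (fun x => Phi (discDeriv (Hamiltonian V G β) e x)) f x ≤
      α * discDeriv (discDeriv (Hamiltonian V G β) f) e x := by
    intro e
    rw [discDeriv_comm]
    exact Phi_sub_le hΦ (hx0 e).1.le
      (sub_nonneg.mp (discDeriv_discDeriv_Hamiltonian_nonneg hβ e f x)) (hx1 e).2.1.le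
  refine (Finset.sum_le_sum fun e _ =>
    mul_le_mul_of_nonneg_left (hlip e) (edgeWeight_nonneg h₁ h₂ j e)).trans ?_
  exact sum_edgeWeight_mul_le (pairConst_nonneg hβ) hα
    (fun e => discDeriv_discDeriv_Hamiltonian_nonneg hβ f e x)
    (fun e => (discDeriv_discDeriv_Hamiltonian_le hβ f e x).trans (hamPair_le hβ f e))
    (fun e he => (discDeriv_discDeriv_Hamiltonian_le hβ f e x).trans
      (hamPair_le_of_not_shareVertex hβ fun h => he h.symm))
    (hx f).2.2.le h₁ h₂ hρ0 hM₁ hM₂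

theorem Subcritical.exists_slope {p : ℝ} (hsub : Subcritical V G β p) (hβ : ∀ i, 0 < β i) :
    ∃ α κ ε : ℝ, 0 < α ∧ dPsi V G β p < κ ∧ 0 < ε ∧ 0 ≤ α * κ ∧ α * κ < 1 ∧
      ∀ r ∈ Set.Icc (Psi V G β p - ε) (Psi V G β p + ε), Phi r * (1 - Phi r) ≤ α := by
  set t := Psi V G β p
  have ht : Phi t = p := hsub.1
  have ha0 : 0 < Phi t * (1 - Phi t) := mul_pos (Phi_pos t) (by linarith [Phi_lt_one t])
  have hp : 0 ≤ p := ht ▸ (Phi_pos t).le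
  have hK := dPsi_nonneg (G := G) hβ hp
  have hder : Phi t * (1 - Phi t) * dPsi V G β p < 1 := by
    have h : HasDerivAt (phiFn V G β) (Phi t * (1 - Phi t) * dPsi V G β p) p :=
      (hasDerivAt_Phi t).comp p (hasDerivAt_Psi V G β p)
    rw [← h.deriv]
    exact hsub.2.2
  have hcont : ContinuousAt (fun δ : ℝ => (Phi t * (1 - Phi t) + δ) * (dPsi V G β p + δ)) 0 := by
    fun_prop
  have hev : ∀ᶠ δ in nhds (0 : ℝ), (Phi t * (1 - Phi t) + δ) * (dPsi V G β p + δ) < 1 :=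
    hcont.eventually_lt_const (by simpa using hder)
  obtain ⟨δ, hδ, hδ0⟩ := ((hev.filter_mono nhdsWithin_le_nhds).and
    (self_mem_nhdsWithin (s := Set.Ioi (0 : ℝ)))).exists
  have hcontΦ : ContinuousAt (fun r => Phi r * (1 - Phi r)) t :=
    (continuous_Phi.mul (continuous_const.sub continuous_Phi)).continuousAt
  obtain ⟨ε, hε, hball⟩ := Metric.eventually_nhds_iff_ball.mp
    (hcontΦ.eventually_lt_const (show Phi t * (1 - Phi t) < Phi t * (1 - Phi t) + δ by linarith))
  refine ⟨Phi t * (1 - Phi t) + δ, dPsi V G β p + δ, ε / 2, by linarith, by linarith, by linarith,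
    by positivity, hδ, fun r hr => (hball r ?_).le⟩
  rw [Metric.mem_ball, Real.dist_eq, abs_lt]
  constructor <;> linarith [hr.1, hr.2]

end Contraction

/-- **(Proposition 5.1: quantitative independence of edge marginals).**
For fixed `k` and boolean values `a, b`, there is `C > 0` such that for all large `n`
and distinct edges `j, i_1, …, i_k`: if `j` shares no vertex with the `i`'s the two
conditional probabilities of `{X_j = 1}` differ by at most `C/n²`; if `j` shares a
vertex with some `i_t`, they differ by at most `C/n`. -/
theorem conditional_marginal_stability {s : ℕ} (V : Fin s → ℕ)
    (G : ∀ i, SimpleGraph (Fin (V i))) (β : Fin s → ℝ) (hβ : ∀ i, 0 < β i)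
    (p : ℝ) (hsub : Subcritical V G β p)
    (k : ℕ) (hk : 0 < k) (a b : Fin k → Bool) :
    ∃ C : ℝ, 0 < C ∧ ∃ N : ℕ, ∀ n : ℕ, N ≤ n →
      ∀ (j : EdgeSet n) (i : Fin k → EdgeSet n),
        Function.Injective i → (∀ t, i t ≠ j) →
        ((∀ t : Fin k, ¬ ShareVertex j (i t)) →
          |condProb (ergmProb V G β) (fun x => x j = true) (fun x => ∀ t, x (i t) = a t) -
            condProb (ergmProb V G β) (fun x => x j = true) (fun x => ∀ t, x (i t) = b t)| ≤
              C / (n : ℝ) ^ 2) ∧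
        ((∃ t : Fin k, ShareVertex j (i t)) →
          |condProb (ergmProb V G β) (fun x => x j = true) (fun x => ∀ t, x (i t) = a t) -
            condProb (ergmProb V G β) (fun x => x j = true) (fun x => ∀ t, x (i t) = b t)| ≤
              C / (n : ℝ)) := by
  obtain ⟨α, κ, ε, hα, hκ, hε, hθ0, hθ1, hΦ⟩ := hsub.exists_slope hβ
  obtain ⟨D, N, hD⟩ := negligible_notMem_typicalSet hβ hsub hε hκ
  have hP := pairConst_nonneg (V := V) hβ
  set P := pairConst V β
  set r : ℝ := (1 - α * κ) / 2 with hr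
  set ρ : ℝ := α * κ + r with hρ
  have hr0 : 0 < r := by linarith
  set M₁ : ℝ := α * P / r with hM₁
  set M₂ : ℝ := α * P * (1 + 6 * M₁) / r with hM₂
  have h₁ : 0 ≤ M₁ := by positivity
  have h₂ : 0 ≤ M₂ := by positivity
  have hc₁ : r * M₁ = α * P := by rw [hM₁]; field_simp
  have hc₂ : r * M₂ = α * P * (1 + 6 * M₁) := by rw [hM₂]; field_simp
  set W : ℝ := 1 + 2 * M₁ + M₂ with hW
  set F : ℝ := Phi (-maxDeriv V G β) ^ k with hF
  have hF0 : 0 < F := pow_pos (Phi_pos _) k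
  set R : ℝ := 4 * W * (|D| / F) with hR
  have hR0 : 0 ≤ R := by positivity
  set C : ℝ := (k * (M₁ + M₂) + R) / r + 1 with hC
  refine ⟨C, by positivity, N, fun n hn j i hi hij => ?_⟩
  have hn1 := one_le_cast_of_edge j
  have hn0 : (0 : ℝ) < n := by linarith
  have hw0 := edgeWeight_nonneg h₁ h₂ j
  have hmain := gibbs_pinned_discrepancy (supermodular_Hamiltonian (n := n) (G := G) hβ) hi hij
    (B := maxDeriv V G β) (fun e x => by
      rw [abs_of_nonneg (discDeriv_Hamiltonian_nonneg hβ e x)]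
      exact discDeriv_Hamiltonian_le hβ e x)
    hw0 (ρ := ρ) (by linarith) (by linarith)
    (ordConnected_typicalSet hβ (Psi V G β p) ε κ)
    (fun x f h0 h1 => sum_edgeWeight_mul_discDeriv_Phi_le hβ hα.le hΦ h₁ h₂ (by linarith)
      (by linarith) (by linarith) j x f h0 h1) a b
  rw [Fintype.card_fin] at hmain
  set Δ : ℝ := |condProb (ergmProb V G β) (fun x => x j = true) (fun x => ∀ t, x (i t) = a t) -
    condProb (ergmProb V G β) (fun x => x j = true) (fun x => ∀ t, x (i t) = b t)| with hΔ
  change (1 - ρ) * edgeWeight M₁ M₂ j j * Δ ≤ _ at hmain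
  have hΔ0 : 0 ≤ Δ := abs_nonneg _
  have hleft : r * Δ ≤ (1 - ρ) * edgeWeight M₁ M₂ j j * Δ := by
    refine mul_le_mul_of_nonneg_right ?_ hΔ0
    have := mul_le_mul_of_nonneg_left (one_le_edgeWeight_self h₁ h₂ j) hr0.le
    have hρr : 1 - ρ = r := by rw [hρ, hr]; ring
    rw [hρr]
    linarith
  have herr : 4 * (∑ e, edgeWeight M₁ M₂ j e) *
      (mass (gibbs (Hamiltonian V G β))
        (fun x => x ∉ typicalSet n V G β (Psi V G β p) ε κ) / F) ≤ R / (n : ℝ) ^ 2 := by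
    have h3 : mass (gibbs (Hamiltonian V G β))
        (fun x => x ∉ typicalSet n V G β (Psi V G β p) ε κ) ≤ |D| / (n : ℝ) ^ 2 :=
      (hD n hn).trans (div_le_div_of_nonneg_right (le_abs_self D) (by positivity))
    have h4 : R / (n : ℝ) ^ 2 = 4 * W * (|D| / (n : ℝ) ^ 2 / F) := by rw [hR]; ring
    rw [h4]
    refine mul_le_mul ?_ (div_le_div_of_nonneg_right h3 hF0.le)
      (div_nonneg (mass_nonneg (fun x => (gibbs_pos _ x).le) _) hF0.le) (by positivity)
    exact mul_le_mul_of_nonneg_left (sum_edgeWeight_le h₁ h₂ j) (by norm_num)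
  have hsum0 : 0 ≤ ∑ t, edgeWeight M₁ M₂ j (i t) := Finset.sum_nonneg fun t _ => hw0 _
  have hbound : r * Δ ≤ ∑ t, edgeWeight M₁ M₂ j (i t) + R / (n : ℝ) ^ 2 := by
    have := mul_le_mul_of_nonneg_right (show ρ ≤ 1 by linarith) hsum0
    linarith
  have hfinish : ∀ (M : ℝ) (q : ℕ), M ≤ M₁ + M₂ → q ≤ 2 →
      (∀ t, edgeWeight M₁ M₂ j (i t) ≤ M / (n : ℝ) ^ q) → Δ ≤ C / (n : ℝ) ^ q := by
    intro M q hM hq ht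
    have h5 : ∑ t, edgeWeight M₁ M₂ j (i t) ≤ k * (M₁ + M₂) / (n : ℝ) ^ q := by
      refine (Finset.sum_le_sum fun t _ => (ht t).trans
        (div_le_div_of_nonneg_right hM (by positivity))).trans (le_of_eq ?_)
      rw [Finset.sum_const, Finset.card_univ, Fintype.card_fin, nsmul_eq_mul, mul_div_assoc]
    have h6 : R / (n : ℝ) ^ 2 ≤ R / (n : ℝ) ^ q :=
      div_le_div_of_nonneg_left hR0 (by positivity) (pow_le_pow_right₀ hn1 hq)
    have h7 : r * Δ ≤ (k * (M₁ + M₂) + R) / (n : ℝ) ^ q := by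
      rw [add_div]
      linarith
    have h8 : Δ ≤ (k * (M₁ + M₂) + R) / r / (n : ℝ) ^ q := by
      rw [div_right_comm, le_div_iff₀ hr0]
      linarith
    exact h8.trans (div_le_div_of_nonneg_right (by linarith) (by positivity))
  constructor
  · intro hsh
    exact hfinish M₂ 2 (by linarith) le_rfl fun t =>
      (edgeWeight_of_not_shareVertex (hij t) fun h => hsh t h.symm).le
  · intro _
    have := hfinish (M₁ + M₂) 1 le_rfl one_le_two fun t => by
      rw [pow_one]
      exact edgeWeight_le_of_ne h₁ h₂ (hij t)
    rwa [pow_one] at this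

end ERGM
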